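/- arXiv:1809.04694 — 2 statements merged into one kernel-verified Lean document; each statement's English description precedes it below -/
import Mathlib

section
/- For every E ∈ ℝ, every real a ≥ ((2-α)/4)·π and every θ ∈ [0,π], there exists a continuous potential q on [0,∞) such that limsup_{x→∞} x^{1-α/2}·|q(x)| = a and the perturbed Stark eigen-equation -u'' - x^α·u + q·u = E·u has an L²(ℝ⁺) solution u satisfying the boundary condition u'(0)·cos θ = u(0)·sin θ. -/
open Filter MeasureTheory Set Real

noncomputable def stN (t : ℝ) : ℝ := 1 + (π * (|(⌊t / π⌋ : ℝ)| + 1)) ^ 2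
noncomputable def stS (t : ℝ) : ℝ := max (-1) (min 1 (stN t * sin (2 * t)))
noncomputable def stW (t : ℝ) : ℝ := ∫ s in (0:ℝ)..t, stS s * sin s ^ 2
noncomputable def stLam (t : ℝ) : ℝ := stW t / sin t ^ 2
noncomputable def stC (t : ℝ) : ℝ := stW t * cos t / sin t ^ 3
noncomputable def stT (t : ℝ) : ℝ :=
  (1/2) * (∫ s in (0:ℝ)..t, stS s * sin (2 * s)) - stW t * cos t / sin t

lemma stN_ge (t : ℝ) : 1 + t ^ 2 ≤ stN t := by
  unfold stN
  have hp := Real.pi_pos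
  have h : |t| ≤ π * (|(⌊t / π⌋ : ℝ)| + 1) := by
    have h1 : |t / π| ≤ |(⌊t / π⌋ : ℝ)| + 1 := by
      have h2 := Int.floor_le (t/π)
      have h3 := Int.lt_floor_add_one (t/π)
      rw [abs_le]
      constructor
      · have := neg_abs_le (⌊t / π⌋ : ℝ); linarith
      · have := le_abs_self (⌊t / π⌋ : ℝ); linarith
    rw [abs_div, abs_of_pos hp, div_le_iff₀ hp] at h1
    linarith
  have := sq_le_sq' (by linarith [abs_nonneg t]) h
  rw [sq_abs] at this
  linarith

lemma stN_le (t : ℝ) : stN t ≤ 1 + (|t| + 2 * π) ^ 2 := by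
  unfold stN
  have hp := Real.pi_pos
  have h : π * (|(⌊t / π⌋ : ℝ)| + 1) ≤ |t| + 2 * π := by
    have h1 : |(⌊t / π⌋ : ℝ)| ≤ |t / π| + 1 := by
      have h2 := Int.floor_le (t/π)
      have h3 := Int.lt_floor_add_one (t/π)
      rw [abs_le]
      constructor
      · have := neg_abs_le (t / π : ℝ); linarith
      · have := le_abs_self (t / π : ℝ); linarith
    rw [abs_div, abs_of_pos hp] at h1
    calc π * (|(⌊t / π⌋ : ℝ)| + 1) ≤ π * ((|t| / π + 1) + 1) := by gcongr
      _ = _ := by field_simp; ring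
  gcongr

lemma stS_abs_le (t : ℝ) : |stS t| ≤ 1 := by
  unfold stS
  rw [abs_le]
  exact ⟨le_max_left _ _, max_le (by norm_num) (min_le_left _ _)⟩

lemma stS_abs_le' (t : ℝ) : |stS t| ≤ stN t * |sin (2 * t)| := by
  have hN : 0 ≤ stN t := by have := stN_ge t; nlinarith
  have e : stN t * |sin (2 * t)| = |stN t * sin (2 * t)| := by rw [abs_mul, abs_of_nonneg hN]
  rw [e]
  unfold stS
  set y := stN t * sin (2 * t)
  rw [abs_le]
  constructor
  · have := neg_abs_le y
    have h0 := abs_nonneg y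
    rcases le_total 1 y with h | h
    · rw [min_eq_left h]; exact le_max_of_le_right (by linarith)
    · rw [min_eq_right h]; exact le_max_of_le_right (by linarith)
  · exact max_le (by linarith [abs_nonneg y]) ((min_le_right _ _).trans (le_abs_self _))

lemma stS_mul_ge (t : ℝ) : |sin (2 * t)| - (1 + t ^ 2)⁻¹ ≤ stS t * sin (2 * t) := by
  have hN := stN_ge t
  have hN0 : 0 < stN t := by nlinarith
  have h1 : (stN t)⁻¹ ≤ (1 + t^2)⁻¹ := by
    apply inv_anti₀ (by positivity) hN
  suffices |sin (2 * t)| - (stN t)⁻¹ ≤ stS t * sin (2 * t) by linarith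
  unfold stS
  set z := sin (2 * t)
  set N := stN t
  have hi : N * N⁻¹ = 1 := mul_inv_cancel₀ hN0.ne'
  have hi0 : 0 < N⁻¹ := by positivity
  rcases le_total 1 (N * z) with h | h
  · rw [min_eq_left h, max_eq_right (by norm_num)]
    have : 0 < z := by by_contra hz; push Not at hz; nlinarith
    rw [abs_of_pos this]; linarith
  · rw [min_eq_right h]
    rcases le_total (-1) (N * z) with h' | h'
    · rw [max_eq_right h']
      have : |z| ≤ N⁻¹ := by
        rw [abs_le]
        constructor
        · have : N⁻¹ * (-1) ≤ N⁻¹ * (N * z) := by gcongr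
          rw [← mul_assoc, mul_comm N⁻¹ N, hi] at this; linarith
        · have : N⁻¹ * (N * z) ≤ N⁻¹ * 1 := by gcongr
          rw [← mul_assoc, mul_comm N⁻¹ N, hi] at this; linarith
      nlinarith [mul_nonneg hN0.le (sq_nonneg z)]
    · rw [max_eq_left h']
      have : z < 0 := by by_contra hz; push Not at hz; nlinarith
      rw [abs_of_neg this]; linarith

lemma sin_ne_of_not (t : ℝ) (h : sin t ≠ 0) : (⌊t/π⌋ : ℝ) * π < t ∧ t < (⌊t/π⌋ + 1 : ℝ) * π := by
  have hp := Real.pi_pos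
  have h2 := Int.floor_le (t/π)
  have h3 := Int.lt_floor_add_one (t/π)
  rw [le_div_iff₀ hp] at h2
  rw [div_lt_iff₀ hp] at h3
  refine ⟨lt_of_le_of_ne h2 ?_, h3⟩
  intro he
  apply h; rw [← he]; exact Real.sin_int_mul_pi _

lemma floor_eq_of (k : ℤ) (t : ℝ) (h1 : (k:ℝ) * π ≤ t) (h2 : t < (k+1:ℝ) * π) : ⌊t/π⌋ = k := by
  have hp := Real.pi_pos
  rw [Int.floor_eq_iff]
  exact ⟨by rwa [le_div_iff₀ hp], by rwa [div_lt_iff₀ hp]⟩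

lemma stS_cont : Continuous stS := by
  rw [continuous_iff_continuousAt]
  intro t
  by_cases h : sin t = 0
  · have h0 : sin (2 * t) = 0 := by rw [Real.sin_two_mul, h]; ring
    have hS0 : stS t = 0 := by
      have := stS_abs_le' t
      rw [h0, abs_zero, mul_zero] at this
      exact abs_nonpos_iff.mp this
    unfold ContinuousAt
    rw [hS0]
    refine squeeze_zero_norm (a := fun t => (1 + (|t| + 2 * π) ^ 2) * |sin (2 * t)|) ?_ ?_
    · intro s
      rw [Real.norm_eq_abs]
      exact (stS_abs_le' s).trans (mul_le_mul_of_nonneg_right (stN_le s) (abs_nonneg _))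
    · have : Continuous (fun t : ℝ => (1 + (|t| + 2 * π) ^ 2) * |sin (2 * t)|) := by fun_prop
      have := this.tendsto t
      simpa [h0] using this
  · obtain ⟨h1, h2⟩ := sin_ne_of_not t h
    have : stS =ᶠ[nhds t] fun s => max (-1) (min 1 ((1 + (π * (|(⌊t / π⌋ : ℝ)| + 1)) ^ 2) * sin (2 * s))) := by
      filter_upwards [Ioo_mem_nhds h1 h2] with s hs
      simp only [stS, stN, floor_eq_of _ s hs.1.le hs.2]
    refine ContinuousAt.congr ?_ this.symm
    fun_prop

lemma stW_deriv (t : ℝ) : HasDerivAt stW (stS t * sin t ^ 2) t := by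
  have hc : Continuous (fun s => stS s * sin s ^ 2) := stS_cont.mul (by fun_prop)
  exact intervalIntegral.integral_hasDerivAt_right (hc.intervalIntegrable _ _)
    (hc.stronglyMeasurableAtFilter _ _) hc.continuousAt

lemma stS_refl (k : ℤ) (s : ℝ) (h1 : (k:ℝ) * π < s) (h2 : s < (k+1:ℝ) * π) :
    stS ((2*k+1) * π - s) = - stS s := by
  have e1 := floor_eq_of k s h1.le h2
  have e2 := floor_eq_of k ((2*k+1) * π - s) (by linarith) (by linarith)
  have e3 : sin (2 * ((2*k+1) * π - s)) = - sin (2 * s) := by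
    have : 2 * ((2*k+1) * π - s) = ((2*k+1 : ℤ):ℝ) * (2*π) - 2 * s := by push_cast; ring
    rw [this, Real.sin_int_mul_two_pi_sub]
  simp only [stS, stN, e1, e2, e3]
  set y := (1 + (π * (|(k : ℝ)| + 1)) ^ 2)
  rw [mul_neg]
  set z := y * sin (2*s)
  simp only [min_def, max_def]
  split_ifs <;> linarith

lemma stW_period (k : ℤ) : ∫ s in ((k:ℝ) * π)..((k+1:ℝ) * π), stS s * sin s ^ 2 = 0 := by
  have hp := Real.pi_pos
  have h := intervalIntegral.integral_comp_sub_left (a := (k:ℝ)*π) (b := (k+1:ℝ)*π)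
    (fun s => stS s * sin s ^ 2) ((2*k+1) * π)
  have e1 : (2*k+1) * π - (k+1:ℝ)*π = (k:ℝ)*π := by ring
  have e2 : (2*k+1) * π - (k:ℝ)*π = (k+1:ℝ)*π := by ring
  rw [e1, e2] at h
  have h' : ∫ s in ((k:ℝ) * π)..((k+1:ℝ) * π), stS ((2*k+1) * π - s) * sin ((2*k+1) * π - s) ^ 2
     = ∫ s in ((k:ℝ) * π)..((k+1:ℝ) * π), -(stS s * sin s ^ 2) := by
    rw [intervalIntegral.integral_of_le (by nlinarith), intervalIntegral.integral_of_le (by nlinarith),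
      integral_Ioc_eq_integral_Ioo, integral_Ioc_eq_integral_Ioo]
    apply setIntegral_congr_fun measurableSet_Ioo
    intro s hs
    have e3 : sin ((2*k+1) * π - s) ^ 2 = sin s ^ 2 := by
      have : ((2*k+1) * π - s) = -(s - ((2*k+1 : ℤ):ℝ) * π) := by push_cast; ring
      rw [this, Real.sin_neg, Real.sin_sub_int_mul_pi, neg_sq, mul_pow, ← zpow_natCast, ← zpow_mul, mul_comm _ ((2:ℕ):ℤ), zpow_mul]
      norm_num
    simp only [stS_refl k s hs.1 hs.2, e3]; ring
  rw [h', intervalIntegral.integral_neg] at h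
  linarith

lemma stW_int (k : ℤ) : stW ((k:ℝ) * π) = 0 := by
  have hc : Continuous (fun s => stS s * sin s ^ 2) := stS_cont.mul (by fun_prop)
  have step : ∀ k : ℤ, stW ((k+1:ℝ) * π) = stW ((k:ℝ)*π) := by
    intro k
    have := intervalIntegral.integral_add_adjacent_intervals (hc.intervalIntegrable (μ := volume) 0 ((k:ℝ)*π))
      (hc.intervalIntegrable (μ := volume) ((k:ℝ)*π) ((k+1:ℝ)*π))
    rw [stW_period] at this
    simp only [stW]; linarith
  induction k using Int.induction_on with
  | zero => simp [stW]
  | succ i ih => have := step i; push_cast at *; rw [this, ih]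
  | pred i ih => 
    have := step (-(i:ℤ) - 1); push_cast at *
    rw [← this, sub_add_cancel, ih]

lemma sin_abs_mono (k : ℤ) (s t : ℝ) (h1 : |s - k * π| ≤ |t - k * π|) (h2 : |t - k * π| ≤ π / 2) :
    |sin s| ≤ |sin t| := by
  have key : ∀ x : ℝ, |x - k * π| ≤ π / 2 → |sin x| = sin |x - k * π| := by
    intro x hx
    have e : |sin x| = |sin (x - k * π)| := by
      rw [Real.sin_sub_int_mul_pi, abs_mul, abs_zpow]; simp
    have hp := Real.pi_pos
    rw [e, Real.abs_sin_eq_sin_abs_of_abs_le_pi (by linarith)]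
  rw [key s (h1.trans h2), key t h2]
  have hp := Real.pi_pos
  exact Real.sin_le_sin_of_le_of_le_pi_div_two (by linarith [abs_nonneg (s - k * π)]) h2 h1

lemma stW_bound (k : ℤ) (t M : ℝ) (n : ℕ) (hM : 0 ≤ M) (ht : |t - k * π| ≤ π / 2)
    (hS : ∀ s, |s - k * π| ≤ |t - k * π| → |stS s| ≤ M * |sin s| ^ n) :
    |stW t| ≤ M * |sin t| ^ (n + 2) * |t - k * π| := by
  have hc : Continuous (fun s => stS s * sin s ^ 2) := stS_cont.mul (by fun_prop)
  have h := intervalIntegral.integral_add_adjacent_intervals (hc.intervalIntegrable (μ := volume) 0 ((k:ℝ)*π))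
      (hc.intervalIntegrable (μ := volume) ((k:ℝ)*π) t)
  have h0 := stW_int k
  simp only [stW] at h0 ⊢
  rw [h0, zero_add] at h
  rw [← h, ← Real.norm_eq_abs]
  apply intervalIntegral.norm_integral_le_of_norm_le_const
  intro s hs
  have hs' : |s - k * π| ≤ |t - k * π| := by
    have := Set.uIoc_subset_uIcc hs
    have := Set.abs_sub_left_of_mem_uIcc this
    exact this
  have hm := sin_abs_mono k s t hs' ht
  rw [Real.norm_eq_abs, abs_mul, abs_pow]
  calc |stS s| * |sin s| ^ 2 ≤ (M * |sin s| ^ n) * |sin s| ^ 2 := by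
        gcongr; exact hS s hs'
    _ = M * |sin s| ^ (n+2) := by ring
    _ ≤ _ := by gcongr

lemma near_int (t : ℝ) : |t - (round (t/π)) * π| ≤ π / 2 := by
  have hp := Real.pi_pos
  have := abs_sub_round (t/π)
  have e : t - (round (t/π)) * π = (t/π - round (t/π)) * π := by field_simp
  rw [e, abs_mul, abs_of_pos hp]
  nlinarith

lemma stW_le (t : ℝ) : |stW t| ≤ 2 * sin t ^ 2 := by
  have h := stW_bound (round (t/π)) t 1 0 (by norm_num) (near_int t)
    (fun s _ => by simpa using stS_abs_le s)
  have := near_int t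
  have hp := Real.pi_lt_d2
  simp only [zero_add, one_mul, sq_abs] at h
  nlinarith [sq_nonneg (sin t)]

lemma stLam_le (t : ℝ) : |stLam t| ≤ 2 := by
  unfold stLam
  by_cases h : sin t = 0
  · simp [h]
  rw [abs_div, abs_of_nonneg (sq_nonneg (sin t)), div_le_iff₀ (by positivity)]
  exact stW_le t

lemma exists_int (t : ℝ) (h : sin t = 0) : ∃ k : ℤ, (k:ℝ) * π = t := Real.sin_eq_zero_iff.mp h

lemma abs_sin_le_sub (k : ℤ) (t : ℝ) : |sin t| ≤ |t - k * π| := by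
  have e : |sin t| = |sin (t - k * π)| := by
    rw [Real.sin_sub_int_mul_pi, abs_mul, abs_zpow]; simp
  rw [e]; exact Real.abs_sin_le_abs

lemma quad_deriv (f : ℝ → ℝ) (c K : ℝ) (h : ∀ᶠ t in nhds c, |f t| ≤ K * |t - c| ^ 2) :
    HasDerivAt f 0 c := by
  have : f =O[nhds c] fun x => ‖x - c‖ ^ 2 := by
    apply Asymptotics.IsBigO.of_bound K
    filter_upwards [h] with t ht
    simpa using ht
  have := Asymptotics.IsBigO.hasFDerivAt (𝕜 := ℝ) this (by norm_num)
  simpa using this.hasDerivAt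

lemma near_ev (k : ℤ) : ∀ᶠ t in nhds ((k:ℝ) * π), |t - k * π| ≤ π / 2 := by
  have hp := Real.pi_pos
  have : Metric.closedBall ((k:ℝ) * π) (π/2) ∈ nhds ((k:ℝ) * π) := Metric.closedBall_mem_nhds _ (by positivity)
  filter_upwards [this] with t ht
  simpa [Real.dist_eq] using ht

lemma stS_zero (t : ℝ) (h : sin t = 0) : stS t = 0 := by
  have h0 : sin (2 * t) = 0 := by rw [Real.sin_two_mul, h]; ring
  have := stS_abs_le' t
  rw [h0, abs_zero, mul_zero] at this
  exact abs_nonpos_iff.mp this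

lemma stLam_deriv (t : ℝ) : HasDerivAt stLam (stS t - 2 * stC t) t := by
  by_cases h : sin t = 0
  · rw [stS_zero t h, stC, h]
    obtain ⟨k, rfl⟩ := exists_int t h
    have e : (0:ℝ) - 2 * (stW (k * π) * cos (k * π) / 0 ^ 3) = 0 := by simp
    rw [e]
    set M : ℝ := 1 + (|(k:ℝ) * π| + 4 * π) ^ 2
    have hM : 0 ≤ M := by positivity
    apply quad_deriv _ _ (M * 2)
    filter_upwards [near_ev k] with t ht
    have hb := stW_bound k t (M * 2) 1 (by positivity) ht (by
      intro s hs
      have h1 := stS_abs_le' s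
      have h2 : stN s ≤ M := by
        refine (stN_le s).trans ?_
        have : |s| ≤ |(k:ℝ) * π| + 2 * π := by
          have := abs_sub_abs_le_abs_sub s (k * π)
          have hp := Real.pi_pos
          linarith
        simp only [M]
        have hp := Real.pi_pos
        gcongr 1 + ?_ ^ 2
        linarith
      have h3 : |sin (2 * s)| ≤ 2 * |sin s| := by
        rw [Real.sin_two_mul, abs_mul, abs_mul]
        have := Real.abs_cos_le_one s
        have h0 := abs_nonneg (sin s)
        simp only [abs_two]
        nlinarith
      calc |stS s| ≤ stN s * |sin (2*s)| := h1
        _ ≤ M * (2 * |sin s|) := by gcongr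
        _ = _ := by ring)
    unfold stLam
    by_cases h : sin t = 0
    · simp [h]; positivity
    rw [abs_div, abs_of_nonneg (sq_nonneg (sin t)), div_le_iff₀ (by positivity)]
    calc |stW t| ≤ _ := hb
      _ = M * 2 * |t - k * π| * |sin t| ^ 2 * |sin t| := by ring
      _ ≤ M * 2 * |t - k * π| * |sin t| ^ 2 * |t - k * π| := by
          exact mul_le_mul_of_nonneg_left (abs_sin_le_sub k t) (by positivity)
      _ = _ := by rw [sq_abs]; ring
  · have := (stW_deriv t).div ((Real.hasDerivAt_sin t).pow 2) (pow_ne_zero 2 h)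
    refine this.congr_deriv ?_
    unfold stC
    simp
    field_simp

lemma stLam_cos (t : ℝ) : stLam t * cos t = sin t * stC t := by
  unfold stLam stC
  by_cases h : sin t = 0
  · simp [h]
  field_simp

lemma stT_deriv (t : ℝ) : HasDerivAt stT (stLam t) t := by
  have hc : Continuous (fun s => stS s * sin (2 * s)) := stS_cont.mul (by fun_prop)
  have h1 : HasDerivAt (fun t => (1/2) * (∫ s in (0:ℝ)..t, stS s * sin (2 * s))) ((1/2) * (stS t * sin (2 * t))) t :=
    (intervalIntegral.integral_hasDerivAt_right (hc.intervalIntegrable _ _)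
    (hc.stronglyMeasurableAtFilter _ _) hc.continuousAt).const_mul _
  by_cases h : sin t = 0
  · have h2 : HasDerivAt (fun t => stW t * cos t / sin t) 0 t := by
      obtain ⟨k, rfl⟩ := exists_int t h
      apply quad_deriv _ _ 1
      filter_upwards [near_ev k] with t ht
      have hb := stW_bound k t 1 0 (by norm_num) ht (fun s _ => by simpa using stS_abs_le s)
      by_cases h : sin t = 0
      · simp [h]; positivity
      rw [abs_div, abs_mul, div_le_iff₀ (by positivity)]
      have hc := Real.abs_cos_le_one t
      have hs := abs_sin_le_sub k t
      have h0 := abs_nonneg (sin t)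
      calc |stW t| * |cos t| ≤ |stW t| * 1 := by gcongr
        _ ≤ 1 * |sin t| ^ (0 + 2) * |t - k * π| := by rw [mul_one]; exact hb
        _ = |t - k * π| * |sin t| * |sin t| := by ring
        _ ≤ |t - k * π| * |t - k * π| * |sin t| := by gcongr
        _ = _ := by ring
    refine (h1.sub h2).congr_deriv ?_
    simp [stLam, h, stS_zero t h]
  · have h2 := ((stW_deriv t).mul (Real.hasDerivAt_cos t)).div (Real.hasDerivAt_sin t) h
    refine (h1.sub h2).congr_deriv ?_
    rw [Real.sin_two_mul]
    unfold stLam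
    simp
    field_simp
    have := Real.sin_sq_add_cos_sq t
    linear_combination (stW t) * this

lemma int_abs_sin (t : ℝ) : 2 * t / π - 1 ≤ ∫ s in (0:ℝ)..t, |sin (2 * s)| := by
  have hp := Real.pi_pos
  have hper : Function.Periodic (fun s : ℝ => |sin (2 * s)|) (π/2) := by
    intro s
    have : 2 * (s + π/2) = 2 * s + π := by ring
    simp only [this, Real.sin_add_pi, abs_neg]
  have hc : Continuous (fun s : ℝ => |sin (2 * s)|) := by fun_prop
  have h := hper.sInf_add_zsmul_le_integral_of_pos (hc.intervalIntegrable _ _) (by positivity) t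
  have h1 : ∫ s in (0:ℝ)..(π/2), |sin (2 * s)| = 1 := by
    have : ∫ s in (0:ℝ)..(π/2), |sin (2 * s)| = ∫ s in (0:ℝ)..(π/2), sin (2 * s) := by
      apply intervalIntegral.integral_congr
      intro s hs
      rw [Set.uIcc_of_le (by positivity)] at hs
      exact abs_of_nonneg (Real.sin_nonneg_of_nonneg_of_le_pi (by linarith [hs.1]) (by linarith [hs.2]))
    rw [this, intervalIntegral.integral_comp_mul_left (fun s => sin s) (by norm_num)]
    simp [mul_div_cancel₀]
    norm_num
  have h2 : 0 ≤ sInf ((fun t => ∫ x in (0:ℝ)..t, |sin (2 * x)|) '' Icc 0 (π/2)) := by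
    apply Real.sInf_nonneg
    rintro _ ⟨y, hy, rfl⟩
    exact intervalIntegral.integral_nonneg hy.1 (fun _ _ => abs_nonneg _)
  rw [h1] at h
  have h3 := Int.lt_floor_add_one (t / (π/2))
  have e : 2 * t / π = t / (π/2) := by field_simp
  rw [e]
  simp at h
  linarith

lemma stT_ge (t : ℝ) (ht : 0 ≤ t) : t / π - 4 ≤ stT t := by
  have hp := Real.pi_pos
  have hp' := Real.pi_lt_d2
  have hc : Continuous (fun s => stS s * sin (2 * s)) := stS_cont.mul (by fun_prop)
  have hc1 : Continuous (fun s : ℝ => |sin (2 * s)|) := by fun_prop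
  have hc2 : Continuous (fun s : ℝ => (1 + s ^ 2)⁻¹) := by
    refine Continuous.inv₀ (by fun_prop) (fun s => by positivity)
  have h1 : ∫ s in (0:ℝ)..t, (|sin (2 * s)| - (1 + s ^ 2)⁻¹) ≤ ∫ s in (0:ℝ)..t, stS s * sin (2 * s) := by
    apply intervalIntegral.integral_mono_on ht ((hc1.sub hc2).intervalIntegrable _ _) (hc.intervalIntegrable _ _)
    intro s _; exact stS_mul_ge s
  rw [intervalIntegral.integral_sub (hc1.intervalIntegrable _ _) (hc2.intervalIntegrable _ _),
    integral_inv_one_add_sq] at h1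
  have h2 := Real.arctan_lt_pi_div_two t
  have h3 := int_abs_sin t
  have h4 : |stW t * cos t / sin t| ≤ 2 := by
    by_cases h : sin t = 0
    · simp [h]
    rw [abs_div, abs_mul, div_le_iff₀ (by positivity)]
    have := stW_le t
    have hc := Real.abs_cos_le_one t
    have hs := Real.abs_sin_le_one t
    calc |stW t| * |cos t| ≤ |stW t| * 1 := by gcongr
      _ ≤ 2 * |sin t| ^ 2 := by rw [mul_one, sq_abs]; exact this
      _ ≤ _ := by nlinarith [abs_nonneg (sin t)]
  have h5 := le_abs_self (stW t * cos t / sin t)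
  unfold stT
  rw [Real.arctan_zero] at h1
  have e : 2 * t / π = 2 * (t/π) := by ring
  rw [e] at h3
  linarith

lemma stS_one (n : ℕ) : stS (n * π + π / 4) = 1 := by
  have e : sin (2 * (n * π + π/4)) = 1 := by
    have : 2 * (n * π + π/4) = π/2 + n * (2 * π) := by ring
    rw [this, Real.sin_add_nat_mul_two_pi, Real.sin_pi_div_two]
  unfold stS
  rw [e, mul_one, min_eq_left, max_eq_right (by norm_num)]
  have := stN_ge (n * π + π/4)
  nlinarith [sq_nonneg (n * π + π/4)]

lemma stLam_cont : Continuous stLam := by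
  rw [continuous_iff_continuousAt]; intro t; exact (stLam_deriv t).continuousAt

lemma ftc_cont (f : ℝ → ℝ) (hf : Continuous f) (x : ℝ) :
    HasDerivAt (fun x => ∫ s in (0:ℝ)..x, f s) (f x) x :=
  intervalIntegral.integral_hasDerivAt_right (hf.intervalIntegrable _ _)
    (hf.stronglyMeasurableAtFilter _ _) hf.continuousAt

noncomputable def stPsi (θ : ℝ) (ρ : ℝ → ℝ) (x : ℝ) : ℝ :=
  (π / 2 - θ) + ∫ s in (0:ℝ)..x, exp (2 * ρ s)
noncomputable def stG (θ : ℝ) (ρ g : ℝ → ℝ) (x : ℝ) : ℝ :=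
  ∫ s in (0:ℝ)..x, g s * stLam (stPsi θ ρ s)
noncomputable def stU (θ : ℝ) (ρ g : ℝ → ℝ) (x : ℝ) : ℝ :=
  exp (-(stG θ ρ g x + ρ x)) * sin (stPsi θ ρ x)
noncomputable def stV (θ : ℝ) (ρ g : ℝ → ℝ) (x : ℝ) : ℝ :=
  exp (-(stG θ ρ g x + ρ x)) * (exp (2 * ρ x) * cos (stPsi θ ρ x)
    - (g x * stLam (stPsi θ ρ x) + deriv ρ x) * sin (stPsi θ ρ x))
noncomputable def stQ (α E θ : ℝ) (ρ g : ℝ → ℝ) (x : ℝ) : ℝ :=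
  E + x ^ α - exp (2 * ρ x) ^ 2 + (g x * stLam (stPsi θ ρ x) + deriv ρ x) ^ 2
   - deriv g x * stLam (stPsi θ ρ x) - deriv (deriv ρ) x - g x * exp (2 * ρ x) * stS (stPsi θ ρ x)

section
variable {α E θ : ℝ} {ρ g : ℝ → ℝ}

lemma stPsi_deriv (hρ : Continuous ρ) (x : ℝ) : HasDerivAt (stPsi θ ρ) (exp (2 * ρ x)) x :=
  (ftc_cont (fun s => exp (2 * ρ s)) (by fun_prop) x).const_add _

lemma stPsi_cont (hρ : Continuous ρ) : Continuous (stPsi θ ρ) :=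
  continuous_iff_continuousAt.2 fun x => (stPsi_deriv hρ x).continuousAt

lemma stG_deriv (hρ : Continuous ρ) (hg : Continuous g) (x : ℝ) :
    HasDerivAt (stG θ ρ g) (g x * stLam (stPsi θ ρ x)) x :=
  ftc_cont _ (hg.mul (stLam_cont.comp (stPsi_cont hρ))) x

lemma cd2 {f : ℝ → ℝ} (hf : ContDiff ℝ 2 f) : (∀ x, HasDerivAt f (deriv f x) x) ∧
    (∀ x, HasDerivAt (deriv f) (deriv (deriv f) x) x) ∧ Continuous (deriv (deriv f)) := by
  have h1 : ContDiff ℝ 1 (deriv f) := by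
    have : ContDiff ℝ (1+1) f := hf
    exact (contDiff_succ_iff_deriv.1 this).2.2
  refine ⟨fun x => (hf.differentiable (by norm_num) x).hasDerivAt, 
    fun x => (h1.differentiable (by norm_num) x).hasDerivAt, h1.continuous_deriv (le_refl _)⟩

lemma stU_deriv (hρ : ContDiff ℝ 2 ρ) (hg : ContDiff ℝ 2 g) (x : ℝ) :
    HasDerivAt (stU θ ρ g) (stV θ ρ g x) x := by
  have hB := ((stG_deriv (θ := θ) hρ.continuous hg.continuous x).add ((cd2 hρ).1 x)).neg.exp
  have hs := (stPsi_deriv (θ := θ) hρ.continuous x).sin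
  refine (hB.mul hs).congr_deriv ?_
  simp only [stV, Pi.add_apply, Pi.neg_apply]
  ring

lemma stV_deriv (hρ : ContDiff ℝ 2 ρ) (hg : ContDiff ℝ 2 g) (x : ℝ) :
    HasDerivAt (stV θ ρ g) ((stQ α E θ ρ g x - E - x ^ α) * stU θ ρ g x) x := by
  have hψ := stPsi_deriv (θ := θ) hρ.continuous x
  have hB := ((stG_deriv (θ := θ) hρ.continuous hg.continuous x).add ((cd2 hρ).1 x)).neg.exp
  have hs := hψ.sin
  have hc := hψ.cos
  have hp := (((cd2 hρ).1 x).const_mul 2).exp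
  have hl := (((cd2 hg).1 x).mul ((stLam_deriv (stPsi θ ρ x)).comp x hψ)).add ((cd2 hρ).2.1 x)
  refine (hB.mul ((hp.mul hc).sub (hl.mul hs))).congr_deriv ?_
  simp only [stU, stQ, Pi.add_apply, Pi.neg_apply, Pi.sub_apply, Pi.mul_apply, Function.comp]
  have := stLam_cos (stPsi θ ρ x)
  generalize stLam (stPsi θ ρ x) = Λ at *
  generalize stS (stPsi θ ρ x) = S at *
  generalize stC (stPsi θ ρ x) = C at *
  generalize exp (-(stG θ ρ g x + ρ x)) = e
  generalize exp (2 * ρ x) = p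
  linear_combination (-2 * e * p * g x) * this

lemma stU_contDiff (hρ : ContDiff ℝ 2 ρ) (hg : ContDiff ℝ 2 g) (hQ : Continuous (stQ 1 0 θ ρ g)) :
    ContDiff ℝ 2 (stU θ ρ g) := by
  have e1 : deriv (stU θ ρ g) = stV θ ρ g := funext fun x => (stU_deriv hρ hg x).deriv
  have e2 : deriv (stV θ ρ g) = _ := funext fun x => (stV_deriv (α := 1) (E := 0) hρ hg x).deriv
  have : ContDiff ℝ (1+1) (stU θ ρ g) := by
    rw [contDiff_succ_iff_deriv]
    refine ⟨fun x => (stU_deriv hρ hg x).differentiableAt, by simp, ?_⟩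
    rw [e1, contDiff_one_iff_deriv]
    refine ⟨fun x => (stV_deriv (α := 1) (E := 0) hρ hg x).differentiableAt, ?_⟩
    rw [e2]
    have hu : Continuous (stU θ ρ g) := continuous_iff_continuousAt.2 fun x => (stU_deriv hρ hg x).continuousAt
    simp only [Real.rpow_one]
    exact ((hQ.sub continuous_const).sub continuous_id).mul hu
  exact this

lemma stQ_cont (hα : 0 < α) (hρ : ContDiff ℝ 2 ρ) (hg : ContDiff ℝ 2 g) : Continuous (stQ α E θ ρ g) := by
  have h0 := hρ.continuous
  have h1 : Continuous (deriv ρ) := hρ.continuous_deriv (by norm_num)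
  have h2 := (cd2 hρ).2.2
  have h3 := hg.continuous
  have h4 : Continuous (deriv g) := hg.continuous_deriv (by norm_num)
  have h5 := stPsi_cont (θ := θ) h0
  have h6 := stLam_cont.comp h5
  have h7 := stS_cont.comp h5
  have h8 : Continuous (fun x : ℝ => x ^ α) := Real.continuous_rpow_const hα.le
  simp only [Function.comp_def] at h6 h7
  unfold stQ
  fun_prop

lemma stPsi_ge (hρ : Continuous ρ) (hρ0 : ∀ x, 0 ≤ ρ x) (hθ : θ ≤ π) (x : ℝ) (hx : 0 ≤ x) :
    x - π / 2 ≤ stPsi θ ρ x := by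
  have : ∫ s in (0:ℝ)..x, (1:ℝ) ≤ ∫ s in (0:ℝ)..x, exp (2 * ρ s) := by
    apply intervalIntegral.integral_mono_on hx (by simp) (Continuous.intervalIntegrable (by fun_prop) _ _)
    intro s _
    exact Real.one_le_exp (by linarith [hρ0 s])
  simp at this
  unfold stPsi
  linarith

/-- lower bound for the decay exponent -/
lemma stG_ge (hρ : ContDiff ℝ 2 ρ) (hg : ContDiff ℝ 2 g) (hρ0 : ∀ x, 0 ≤ ρ x) (hθ : θ ≤ π)
    (h : ℝ → ℝ) (X : ℝ) (hX : 3 ≤ X) (hh : ∀ x ≥ X, HasDerivAt h (g x) x)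
    (hg0 : ∀ x ≥ X, 0 ≤ g x) (hg1 : ∀ x ≥ X, deriv g x ≤ 0) (hρ1 : ∀ x ≥ X, 0 ≤ deriv ρ x) :
    ∃ C, ∀ x ≥ X, h x / π - C ≤ stG θ ρ g x := by
  set τ : ℝ → ℝ := fun x => stT (stPsi θ ρ x) - stPsi θ ρ x / π + 4 with hτ
  set D : ℝ → ℝ := fun x => stG θ ρ g x - h x / π - (g x * exp (-2 * ρ x)) * τ x with hD
  have hτ0 : ∀ x ≥ X, 0 ≤ τ x := by
    intro x hx
    have h1 := stPsi_ge hρ.continuous hρ0 hθ x (by linarith)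
    have h2 := Real.pi_lt_d2
    have := stT_ge (stPsi θ ρ x) (by linarith)
    simp only [hτ]; linarith
  have hd : ∀ x ≥ X, HasDerivAt D (-(deriv g x - 2 * deriv ρ x * g x) * exp (-2 * ρ x) * τ x) x := by
    intro x hx
    have hψ := stPsi_deriv (θ := θ) hρ.continuous x
    have h1 : HasDerivAt τ _ x := (((stT_deriv (stPsi θ ρ x)).comp x hψ).sub (hψ.div_const π)).add_const 4
    have h2 := ((cd2 hg).1 x).mul (((cd2 hρ).1 x).const_mul (-2)).exp
    have h3 := ((stG_deriv (θ := θ) hρ.continuous hg.continuous x).sub ((hh x hx).div_const π)).sub (h2.mul h1)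
    refine h3.congr_deriv ?_
    simp only [Pi.mul_apply]
    have e : exp (-2 * ρ x) * exp (2 * ρ x) = 1 := by rw [← Real.exp_add]; simp
    linear_combination (-(g x * stLam (stPsi θ ρ x)) + g x / π) * e
  have hmono : MonotoneOn D (Ici X) := by
    apply monotoneOn_of_deriv_nonneg (convex_Ici X)
    · intro x hx; exact (hd x hx).continuousAt.continuousWithinAt
    · intro x hx; rw [interior_Ici] at hx; exact (hd x (le_of_lt hx)).differentiableAt.differentiableWithinAt
    · intro x hx; rw [interior_Ici] at hx
      have hx' : X ≤ x := le_of_lt hx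
      rw [(hd x hx').deriv]
      have := hτ0 x hx'
      have h1 := hg1 x hx'
      have h2 := mul_nonneg (hρ1 x hx') (hg0 x hx')
      have : 0 ≤ -(deriv g x - 2 * deriv ρ x * g x) := by linarith
      positivity
  refine ⟨-D X, fun x hx => ?_⟩
  have h1 := hmono (mem_Ici.2 le_rfl) (mem_Ici.2 hx) hx
  have h2 : 0 ≤ (g x * exp (-2 * ρ x)) * τ x := by
    have := hτ0 x hx
    have := hg0 x hx
    positivity
  have h3 : D x = stG θ ρ g x - h x / π - (g x * exp (-2 * ρ x)) * τ x := rfl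
  linarith
end

lemma cutoff (f : ℝ → ℝ) (X : ℝ) (hf : ContDiffOn ℝ 2 f (Ioi X)) (hf0 : ∀ x > X, 0 ≤ f x) :
    ∃ F : ℝ → ℝ, ContDiff ℝ 2 F ∧ (∀ x, 0 ≤ F x) ∧ (∀ x ≤ X + 1, F x = 0) ∧ (∀ x ≥ X + 2, F x = f x) := by
  refine ⟨fun x => smoothTransition (x - X - 1) * f x, ?_, ?_, ?_, ?_⟩
  · rw [contDiff_iff_contDiffAt]
    intro x
    rcases lt_or_ge X x with h | h
    · refine ContDiffAt.mul ?_ (hf.contDiffAt (Ioi_mem_nhds h))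
      have : ContDiff ℝ 2 smoothTransition := smoothTransition.contDiff (n := 2)
      exact (this.comp (by fun_prop : ContDiff ℝ 2 (fun x : ℝ => x - X - 1))).contDiffAt
    · have : (fun x => smoothTransition (x - X - 1) * f x) =ᶠ[nhds x] fun _ => 0 := by
        filter_upwards [Iio_mem_nhds (show x < X + 1 by linarith)] with y hy
        rw [smoothTransition.zero_of_nonpos (by have := mem_Iio.1 hy; linarith), zero_mul]
      exact contDiffAt_const.congr_of_eventuallyEq this
  · intro x
    rcases lt_or_ge X x with h | h
    · exact mul_nonneg (smoothTransition.nonneg _) (hf0 x h)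
    · simp only; rw [smoothTransition.zero_of_nonpos (by linarith), zero_mul]
  · intro x hx
    simp only; rw [smoothTransition.zero_of_nonpos (by linarith), zero_mul]
  · intro x hx
    simp only; rw [smoothTransition.one_of_one_le (by linarith), one_mul]

lemma limsup_lemma (a : ℝ) (r β S q : ℝ → ℝ) (ha : 0 < a) (hr : Tendsto r atTop (nhds 0))
    (hβ : Tendsto β atTop (nhds a)) (hS : ∀ x, |S x| ≤ 1) (hS1 : ∃ᶠ x in atTop, S x = 1)
    (hq : ∀ᶠ x in atTop, q x = |r x - β x * S x|) : limsup q atTop = a := by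
  have hup : ∀ ε > 0, ∀ᶠ x in atTop, q x ≤ a + ε := by
    intro ε hε
    filter_upwards [hq, hr.eventually (Metric.ball_mem_nhds 0 (half_pos hε)),
      hβ.eventually (Metric.ball_mem_nhds a (half_pos hε))] with x h1 h2 h3
    rw [Real.dist_eq] at h2 h3
    rw [h1]
    have h4 := abs_sub (r x) (β x * S x)
    rw [abs_mul] at h4
    have h5 : |β x| ≤ a + ε/2 := by
      have := abs_sub_abs_le_abs_sub (β x) a
      rw [abs_of_pos ha] at this; linarith
    have := hS x
    have : |β x| * |S x| ≤ |β x| * 1 := by gcongr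
    rw [sub_zero] at h2
    linarith
  have hlow : ∀ ε > 0, ∃ᶠ x in atTop, a - ε ≤ q x := by
    intro ε hε
    refine (hS1.and_eventually (hq.and ((hr.eventually (Metric.ball_mem_nhds 0 (half_pos hε))).and
      (hβ.eventually (Metric.ball_mem_nhds a (half_pos hε)))))).mono ?_
    rintro x ⟨h0, h1, h2, h3⟩
    rw [Real.dist_eq, abs_lt] at h2 h3
    rw [h1, h0]
    have := neg_abs_le (r x - β x * 1)
    linarith [h2.1, h2.2, h3.1, h3.2]
  have hbdd : IsBoundedUnder (· ≤ ·) atTop q := ⟨a + 1, hup 1 one_pos⟩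
  have hcob : IsCoboundedUnder (· ≤ ·) atTop q := 
    IsCoboundedUnder.of_frequently_ge (hlow 1 one_pos)
  apply le_antisymm
  · apply le_of_forall_pos_le_add
    intro ε hε
    exact limsup_le_of_le hcob (hup ε hε)
  · apply le_of_forall_pos_sub_le
    intro ε hε
    exact le_limsup_of_frequently_le (hlow ε hε) hbdd

lemma deriv_ev (F f : ℝ → ℝ) (X : ℝ) (h : ∀ x ≥ X, F x = f x) (x : ℝ) (hx : X < x) (d : ℝ)
    (hd : HasDerivAt f d x) : HasDerivAt F d x := by
  apply hd.congr_of_eventuallyEq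
  filter_upwards [Ioi_mem_nhds hx] with y hy
  exact h y (le_of_lt hy)

lemma rho_deriv (α E x : ℝ) (hx : 0 < x) (hV : 0 < x ^ α + E) :
    HasDerivAt (fun x : ℝ => (1/4) * log (x ^ α + E)) ((α / 4) * x ^ (α - 1) / (x ^ α + E)) x := by
  have h1 := ((Real.hasDerivAt_rpow_const (p := α) (Or.inl hx.ne')).add_const E).log hV.ne'
  refine (h1.const_mul (1/4)).congr_deriv ?_
  ring

lemma rho_deriv2 (α E x : ℝ) (hx : 0 < x) (hV : 0 < x ^ α + E) :
    HasDerivAt (fun x : ℝ => (α / 4) * x ^ (α - 1) / (x ^ α + E))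
      (((α / 4) * ((α - 1) * x ^ (α - 1 - 1)) * (x ^ α + E) - (α / 4) * x ^ (α - 1) * (α * x ^ (α - 1)))
        / (x ^ α + E) ^ 2) x := by
  have h1 := ((Real.hasDerivAt_rpow_const (p := α) (Or.inl hx.ne')).add_const E)
  have h2 := (Real.hasDerivAt_rpow_const (p := α - 1) (Or.inl hx.ne')).const_mul (α / 4)
  exact h2.div h1 hV.ne'

lemma rho_bounds (α E x : ℝ) (h0 : 0 < α) (h2 : α < 2) (hx : 0 < x) (hV : x ^ α / 2 ≤ x ^ α + E) :
    0 ≤ (α / 4) * x ^ (α - 1) / (x ^ α + E) ∧ (α / 4) * x ^ (α - 1) / (x ^ α + E) ≤ 1 / x ∧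
    |((α / 4) * ((α - 1) * x ^ (α - 1 - 1)) * (x ^ α + E) - (α / 4) * x ^ (α - 1) * (α * x ^ (α - 1)))
        / (x ^ α + E) ^ 2| ≤ 5 / x ^ 2 := by
  have hy : 0 < x ^ α := Real.rpow_pos_of_pos hx _
  have e1 : x ^ (α - 1) = x ^ α / x := by rw [Real.rpow_sub hx, Real.rpow_one]
  have e2 : x ^ (α - 1 - 1) = x ^ α / x / x := by rw [Real.rpow_sub hx, e1, Real.rpow_one]
  rw [e2, e1]
  set y := x ^ α
  set V := y + E
  have hV0 : 0 < V := by linarith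
  have hz : y / V ≤ 2 := by rw [div_le_iff₀ hV0]; linarith
  have hz0 : 0 ≤ y / V := by positivity
  have f1 : (α / 4) * (y / x) / V = (α / 4 * (y / V)) * (1 / x) := by field_simp
  have f2 : ((α / 4) * ((α - 1) * (y / x / x)) * V - (α / 4) * (y / x) * (α * (y / x))) / V ^ 2
     = (α / 4 * (α - 1) * (y / V) - α ^ 2 / 4 * (y / V) ^ 2) * (1 / x ^ 2) := by field_simp
  set z := y / V
  have hx1 : 0 < 1 / x := by positivity
  have hx2 : 0 < 1 / x ^ 2 := by positivity
  refine ⟨by positivity, ?_, ?_⟩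
  · rw [f1]
    have : α / 4 * z ≤ 1 := by nlinarith
    nlinarith
  · rw [f2, abs_mul, abs_of_pos hx2]
    have : |α / 4 * (α - 1) * z - α ^ 2 / 4 * z ^ 2| ≤ 5 := by
      have g1 : |α / 4 * (α - 1) * z| ≤ 1 := by
        rw [abs_mul, abs_mul, abs_of_pos (by positivity : 0 < α / 4), abs_of_nonneg hz0]
        have : |α - 1| ≤ 1 := by rw [abs_le]; constructor <;> linarith
        calc α / 4 * |α - 1| * z ≤ (2/4) * 1 * 2 := by gcongr
          _ = 1 := by norm_num
      have g2 : |α ^ 2 / 4 * z ^ 2| ≤ 4 := by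
        rw [abs_of_nonneg (by positivity)]
        calc α ^ 2 / 4 * z ^ 2 ≤ 2 ^ 2 / 4 * 2 ^ 2 := by gcongr
          _ = 4 := by norm_num
      have := abs_sub (α / 4 * (α - 1) * z) (α ^ 2 / 4 * z ^ 2)
      linarith
    calc _ ≤ 5 * (1 / x ^ 2) := by gcongr
      _ = _ := by ring

lemma h_deriv (a x : ℝ) (hx : 1 < x) :
    HasDerivAt (fun x => a * log x + π * log (log x)) (a / x + π / (x * log x)) x := by
  have hl : 0 < log x := Real.log_pos hx
  have h0 : x ≠ 0 := by linarith
  have h1 := Real.hasDerivAt_log h0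
  refine ((h1.const_mul a).add ((h1.log hl.ne').const_mul π)).congr_deriv ?_
  field_simp

lemma g_deriv (a x : ℝ) (hx : 1 < x) :
    HasDerivAt (fun x => a / x + π / (x * log x)) (-(a / x ^ 2) - π * (log x + 1) / (x * log x) ^ 2) x := by
  have hl : 0 < log x := Real.log_pos hx
  have h0 : x ≠ 0 := by linarith
  have h1 := Real.hasDerivAt_log h0
  have h2 := (hasDerivAt_id x).mul h1
  have h3 := (hasDerivAt_const x a).div (hasDerivAt_id x) h0
  have h4 := (hasDerivAt_const x π).div h2 (mul_ne_zero h0 hl.ne')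
  refine (h3.add h4).congr_deriv ?_
  simp
  field_simp
  ring

lemma g_bounds (a x : ℝ) (ha : 0 < a) (hx : 3 ≤ x) :
    0 ≤ a / x + π / (x * log x) ∧ a / x + π / (x * log x) ≤ (a + π) / x ∧
    -(a / x ^ 2) - π * (log x + 1) / (x * log x) ^ 2 ≤ 0 ∧
    |-(a / x ^ 2) - π * (log x + 1) / (x * log x) ^ 2| ≤ (a + 2 * π) / x ^ 2 := by
  have hp := Real.pi_pos
  have hx0 : 0 < x := by linarith
  have hl : 1 ≤ log x := by
    rw [Real.le_log_iff_exp_le hx0]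
    linarith [Real.exp_one_lt_d9]
  set l := log x
  have f1 : π / (x * l) ≤ π / x := by
    apply div_le_div_of_nonneg_left hp.le hx0; nlinarith
  have f2 : π * (l + 1) / (x * l) ^ 2 ≤ 2 * π / x ^ 2 := by
    rw [div_le_div_iff₀ (by positivity) (by positivity)]
    have : l + 1 ≤ 2 * l ^ 2 := by nlinarith
    calc π * (l + 1) * x ^ 2 ≤ π * (2 * l ^ 2) * x ^ 2 := by gcongr
      _ = _ := by ring
  have f3 : 0 ≤ π * (l + 1) / (x * l) ^ 2 := by positivity
  have f4 : 0 ≤ a / x ^ 2 := by positivity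
  refine ⟨by positivity, ?_, by linarith, ?_⟩
  · rw [add_div]; linarith
  · rw [abs_of_nonpos (by linarith), add_div]; linarith

lemma exists_X (α E : ℝ) (h0 : 0 < α) : ∃ X : ℝ, 3 ≤ X ∧ ∀ x ≥ X, 2 * |E| + 2 ≤ x ^ α := by
  have := (tendsto_rpow_atTop h0).eventually_ge_atTop (2 * |E| + 2)
  obtain ⟨X, hX⟩ := eventually_atTop.1 this
  exact ⟨max 3 X, le_max_left _ _, fun x hx => hX x ((le_max_right _ _).trans hx)⟩

lemma beta_tendsto (α E a : ℝ) (h0 : 0 < α) :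
    Tendsto (fun x : ℝ => (a + π / log x) * sqrt (1 + E * x ^ (-α))) atTop (nhds a) := by
  have h1 : Tendsto (fun x : ℝ => a + π / log x) atTop (nhds (a + 0)) :=
    tendsto_const_nhds.add (tendsto_log_atTop.const_div_atTop π)
  have h2 : Tendsto (fun x : ℝ => sqrt (1 + E * x ^ (-α))) atTop (nhds (sqrt (1 + E * 0))) := by
    apply (Real.continuous_sqrt.tendsto _).comp
    exact tendsto_const_nhds.add ((tendsto_rpow_neg_atTop h0).const_mul E)
  simpa using h1.mul h2

lemma beta_eq (α E a x : ℝ) (hx : 1 < x) (hV : 0 < x ^ α + E) :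
    x ^ (1 - α / 2) * ((a / x + π / (x * log x)) * exp (2 * ((1/4) * log (x ^ α + E))))
      = (a + π / log x) * sqrt (1 + E * x ^ (-α)) := by
  have hx0 : 0 < x := by linarith
  have hl : 0 < log x := Real.log_pos hx
  have hy : 0 < x ^ α := Real.rpow_pos_of_pos hx0 _
  have e1 : exp (2 * ((1/4) * log (x ^ α + E))) = sqrt (x ^ α + E) := by
    rw [Real.sqrt_eq_rpow, Real.rpow_def_of_pos hV]; congr 1; ring
  have e2 : x ^ (1 - α / 2) = x / sqrt (x ^ α) := by
    rw [Real.sqrt_eq_rpow, ← Real.rpow_mul hx0.le, Real.rpow_sub hx0, Real.rpow_one]; congr 2; ring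
  have e3 : 1 + E * x ^ (-α) = (x ^ α + E) / x ^ α := by
    rw [Real.rpow_neg hx0.le]; field_simp
  rw [e1, e2, e3, Real.sqrt_div hV.le]
  have : sqrt (x ^ α) ≠ 0 := by positivity
  field_simp

/-- For every `E ∈ ℝ`, every `a ≥ ((2-α)/4)·π` and every `θ ∈ [0,π]`, there is a
continuous potential `q` on `[0,∞)` with `limsup_{x→∞} x^{1-α/2}·|q(x)| = a` such that the
perturbed Stark eigen-equation `-u'' - x^α·u + q·u = E·u` has an `L²(ℝ⁺)` solution `u`
satisfying the boundary condition `u'(0)·cos θ = u(0)·sin θ`. -/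
theorem stark_eigenvalue_exists
    (α : ℝ) (hα0 : 0 < α) (hα2 : α < 2)
    (E a θ : ℝ) (ha : ((2 - α) / 4) * Real.pi ≤ a) (hθ : θ ∈ Set.Icc 0 Real.pi) :
    ∃ q : ℝ → ℝ, ContinuousOn q (Set.Ici 0) ∧
      Filter.limsup (fun x : ℝ => x ^ (1 - α / 2) * |q x|) Filter.atTop = a ∧
      ∃ u : ℝ → ℝ, ContDiffOn ℝ 2 u (Set.Ici 0) ∧
        (∀ x : ℝ, 0 < x →
          -(deriv (deriv u) x) - x ^ α * u x + q x * u x = E * u x) ∧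
        (∃ x ∈ Set.Ici (0 : ℝ), u x ≠ 0) ∧
        MeasureTheory.IntegrableOn (fun x => (u x) ^ 2) (Set.Ioi 0) ∧
        deriv u 0 * Real.cos θ = u 0 * Real.sin θ := by
  have hp := Real.pi_pos
  have ha0 : 0 < a := lt_of_lt_of_le (by apply mul_pos _ hp; linarith) ha
  obtain ⟨X, hX3, hX⟩ := exists_X α E hα0
  have hVh : ∀ x ≥ X, x ^ α / 2 ≤ x ^ α + E := by
    intro x hx
    have := hX x hx; have := neg_abs_le E; have := abs_nonneg E; linarith
  have hV1 : ∀ x ≥ X, 1 ≤ x ^ α + E := by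
    intro x hx
    have := hX x hx; have := neg_abs_le E; have := abs_nonneg E; linarith
  obtain ⟨ρ, hρ, hρ0, hρz, hρe⟩ := cutoff (fun x : ℝ => (1/4) * log (x ^ α + E)) X (by
    intro x hx
    have hx' : X < x := hx
    have h1 := hV1 x hx'.le
    apply ContDiffAt.contDiffWithinAt
    refine contDiffAt_const.mul (ContDiffAt.log ?_ (by linarith))
    exact (Real.contDiffAt_rpow_const_of_ne (by linarith)).add contDiffAt_const) (by
    intro x hx
    have := Real.log_nonneg (hV1 x hx.le)
    positivity)
  obtain ⟨g, hg, hg0, hgz, hge⟩ := cutoff (fun x : ℝ => a / x + π / (x * log x)) X (by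
    intro x hx
    have hx' : X < x := hx
    have hl : 0 < log x := Real.log_pos (by linarith)
    have h0 : x ≠ 0 := by linarith
    apply ContDiffAt.contDiffWithinAt
    refine (contDiffAt_const.div contDiffAt_id h0).add (contDiffAt_const.div (contDiffAt_id.mul (Real.contDiffAt_log.2 h0)) ?_)
    exact mul_ne_zero h0 hl.ne') (fun x hx => (g_bounds a x ha0 (by linarith)).1)
  set Y := X + 3 with hY
  have hρ1 : ∀ x > X + 2, deriv ρ x = (α / 4) * x ^ (α - 1) / (x ^ α + E) := fun x hx =>
    (deriv_ev _ _ _ hρe x hx _ (rho_deriv α E x (by linarith) (by linarith [hV1 x (by linarith)]))).deriv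
  have hρ2 : ∀ x ≥ Y, deriv (deriv ρ) x = _ := fun x hx =>
    (deriv_ev _ _ (X + 2.5) (fun y hy => hρ1 y (by norm_num at *; linarith)) x (by norm_num at *; linarith) _ (rho_deriv2 α E x (by linarith) (by linarith [hV1 x (by linarith)]))).deriv
  have hg1 : ∀ x ≥ Y, deriv g x = _ := fun x hx =>
    (deriv_ev _ _ _ hge x (by linarith) _ (g_deriv a x (by linarith))).deriv
  have hQ : Continuous (stQ α E θ ρ g) := stQ_cont hα0 hρ hg
  have hU2 : ContDiff ℝ 2 (stU θ ρ g) := stU_contDiff hρ hg (stQ_cont one_pos hρ hg)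
  have hUV : deriv (stU θ ρ g) = stV θ ρ g := funext fun x => (stU_deriv hρ hg x).deriv
  have hVd : deriv (stV θ ρ g) = fun x => (stQ α E θ ρ g x - E - x ^ α) * stU θ ρ g x :=
    funext fun x => (stV_deriv hρ hg x).deriv
  have hψge := fun x hx => stPsi_ge (θ := θ) hρ.continuous hρ0 hθ.2 x hx
  have hψtop : Tendsto (stPsi θ ρ) atTop atTop := by
    apply tendsto_atTop_mono' atTop (f₁ := fun x => x - π / 2)
    · filter_upwards [eventually_ge_atTop 0] with x hx using hψge x hx
    · exact tendsto_atTop_add_const_right _ _ tendsto_id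
  refine ⟨stQ α E θ ρ g, hQ.continuousOn, ?_, stU θ ρ g, hU2.contDiffOn, ?_, ?_, ?_, ?_⟩
  · -- limsup
    set K : ℝ := ((a + π) * 2 + 1) ^ 2 + (a + 2 * π) * 2 + 5 with hK
    refine limsup_lemma a (fun x => x ^ (1 - α / 2) * ((g x * stLam (stPsi θ ρ x) + deriv ρ x) ^ 2
       - deriv g x * stLam (stPsi θ ρ x) - deriv (deriv ρ) x))
       (fun x => (a + π / log x) * sqrt (1 + E * x ^ (-α))) (fun x => stS (stPsi θ ρ x)) _ ha0 ?_
       (beta_tendsto α E a hα0) (fun x => stS_abs_le _) ?_ ?_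
    · have hz : Tendsto (fun x : ℝ => K * x ^ (-(1 + α / 2))) atTop (nhds 0) := by
        simpa using (tendsto_rpow_neg_atTop (by positivity : 0 < 1 + α / 2)).const_mul K
      refine squeeze_zero_norm' ?_ hz
      filter_upwards [eventually_ge_atTop Y] with x hx
      have hx0 : 0 < x := by linarith
      obtain ⟨b1, b2, b3⟩ := rho_bounds α E x hα0 hα2 hx0 (hVh x (by linarith))
      obtain ⟨c1, c2, c3, c4⟩ := g_bounds a x ha0 (by linarith)
      rw [← hρ1 x (by linarith)] at b1 b2
      rw [← hρ2 x hx] at b3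
      rw [← hg1 x hx] at c3 c4
      have := hge x (by linarith)
      rw [← this] at c1 c2
      have hL := stLam_le (stPsi θ ρ x)
      set Λ := stLam (stPsi θ ρ x)
      have d1 : |g x * Λ + deriv ρ x| ≤ ((a + π) * 2 + 1) / x := by
        calc |g x * Λ + deriv ρ x| ≤ |g x * Λ| + |deriv ρ x| := abs_add_le _ _
          _ = g x * |Λ| + deriv ρ x := by rw [abs_mul, abs_of_nonneg c1, abs_of_nonneg b1]
          _ ≤ (a + π) / x * 2 + 1 / x := by gcongr
          _ = _ := by ring
      have d2 : (g x * Λ + deriv ρ x) ^ 2 ≤ ((a + π) * 2 + 1) ^ 2 / x ^ 2 := by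
        rw [← sq_abs, ← div_pow]; gcongr
      have d3 : |deriv g x * Λ| ≤ (a + 2 * π) * 2 / x ^ 2 := by
        rw [abs_mul]
        calc |deriv g x| * |Λ| ≤ (a + 2 * π) / x ^ 2 * 2 := by gcongr
          _ = _ := by ring
      have d4 : |(g x * Λ + deriv ρ x) ^ 2 - deriv g x * Λ - deriv (deriv ρ) x| ≤ K / x ^ 2 := by
        have t1 := abs_sub ((g x * Λ + deriv ρ x) ^ 2 - deriv g x * Λ) (deriv (deriv ρ) x)
        have t2 := abs_sub ((g x * Λ + deriv ρ x) ^ 2) (deriv g x * Λ)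
        rw [abs_of_nonneg (sq_nonneg (g x * Λ + deriv ρ x))] at t2
        rw [hK, add_div, add_div]
        linarith
      have hr : 0 < x ^ (1 - α / 2) := Real.rpow_pos_of_pos hx0 _
      rw [Real.norm_eq_abs, abs_mul, abs_of_pos hr]
      calc _ ≤ x ^ (1 - α / 2) * (K / x ^ 2) := by gcongr
        _ = K * x ^ (-(1 + α / 2)) := by
          have : -(1 + α / 2) = (1 - α / 2) - 2 := by ring
          rw [this, Real.rpow_sub hx0 (1 - α / 2) 2, Real.rpow_two]; ring
    · rw [frequently_atTop]
      intro b
      obtain ⟨n, hn⟩ := exists_nat_gt ((stPsi θ ρ (max b 0)) / π)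
      rw [div_lt_iff₀ hp] at hn
      obtain ⟨c, hc⟩ := (hψtop.eventually_ge_atTop (n * π + π / 4)).and (eventually_ge_atTop (max b 0)) |>.exists
      have := intermediate_value_Icc hc.2 (stPsi_cont (θ := θ) hρ.continuous).continuousOn
      obtain ⟨y, hy, hye⟩ := this ⟨by linarith, hc.1⟩
      exact ⟨y, (le_max_left _ _).trans hy.1, by rw [hye, stS_one]⟩
    · filter_upwards [eventually_ge_atTop Y] with x hx
      have hx0 : 0 < x := by linarith
      have hVp : 0 < x ^ α + E := by linarith [hV1 x (by linarith)]
      have hr : 0 < x ^ (1 - α / 2) := Real.rpow_pos_of_pos hx0 _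
      have hb := beta_eq α E a x (by linarith) hVp
      have e1 := hge x (by linarith)
      have e2 := hρe x (by linarith)
      rw [← e1, ← e2] at hb
      rw [← hb, ← abs_of_pos hr, ← abs_mul, abs_of_pos hr]
      congr 1
      have e3 : exp (2 * ρ x) ^ 2 = x ^ α + E := by
        rw [e2, ← Real.exp_nat_mul]
        have : ((2:ℕ):ℝ) * (2 * (1 / 4 * log (x ^ α + E))) = log (x ^ α + E) := by push_cast; ring
        rw [this, Real.exp_log hVp]
      unfold stQ
      rw [e3]; ring
  · intro x _
    rw [hUV, hVd]; ring
  · obtain ⟨n, hn⟩ := exists_nat_gt ((stPsi θ ρ 0) / π)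
    rw [div_lt_iff₀ hp] at hn
    obtain ⟨c, hc⟩ := (hψtop.eventually_ge_atTop (n * π + π / 2)).and (eventually_ge_atTop 0) |>.exists
    have := intermediate_value_Icc hc.2 (stPsi_cont (θ := θ) hρ.continuous).continuousOn
    obtain ⟨y, hy, hye⟩ := this ⟨by linarith, hc.1⟩
    refine ⟨y, hy.1, ?_⟩
    unfold stU
    rw [hye, Real.sin_add_pi_div_two]
    refine mul_ne_zero (Real.exp_pos _).ne' ?_
    have : |cos (n * π)| = 1 := Real.abs_cos_int_mul_pi n
    intro h0; rw [h0] at this; simp at this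
  · -- L²
    obtain ⟨C, hC⟩ := stG_ge (θ := θ) hρ hg hρ0 hθ.2 (fun x => a * log x + π * log (log x)) Y (by linarith)
      (fun x hx => by
        have := h_deriv a x (by linarith)
        rw [hge x (by linarith)]; exact this)
      (fun x _ => hg0 x)
      (fun x hx => by rw [hg1 x hx]; exact (g_bounds a x ha0 (by linarith)).2.2.1)
      (fun x hx => by rw [hρ1 x (by linarith)]; exact (rho_bounds α E x hα0 hα2 (by linarith) (hVh x (by linarith))).1)
    have hcont : Continuous (fun x => stU θ ρ g x ^ 2) := hU2.continuous.pow 2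
    have : Ioi (0:ℝ) = Ioc 0 Y ∪ Ioi Y := (Ioc_union_Ioi_eq_Ioi (by linarith)).symm
    rw [this]
    refine IntegrableOn.union ((hcont.integrableOn_Icc (a := 0) (b := Y)).mono_set Ioc_subset_Icc_self) ?_
    have hI := (integrableOn_inv_div_log_sq_Ioi (c := Y) (by linarith)).const_mul (exp (2 * C + log 2 / 2))
    refine Integrable.mono' hI hcont.aestronglyMeasurable ?_
    refine (ae_restrict_iff' measurableSet_Ioi).2 (Eventually.of_forall ?_)
    intro x hx
    have hx' : Y < x := hx
    have hx0 : 0 < x := by linarith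
    have hl : 0 < log x := Real.log_pos (by linarith)
    have h1 := hC x hx'.le
    have h2 := hρe x (by linarith)
    have hy : 0 < x ^ α := Real.rpow_pos_of_pos hx0 _
    have h3 : log (x ^ α / 2) ≤ log (x ^ α + E) := Real.log_le_log (by positivity) (hVh x (by linarith))
    rw [Real.log_div hy.ne' (by norm_num), Real.log_rpow hx0] at h3
    have h4 : (2 - α) / 4 ≤ a / π := by rw [le_div_iff₀ hp]; exact ha
    have h5 : (2 - α) / 4 * log x ≤ a / π * log x := by gcongr
    have h6 : (a * log x + π * log (log x)) / π = a / π * log x + log (log x) := by field_simp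
    rw [h6] at h1
    have h7 : x⁻¹ / log x ^ 2 = exp (- log x - 2 * log (log x)) := by
      rw [Real.exp_sub, Real.exp_neg, Real.exp_log hx0]
      congr 1
      have : 2 * log (log x) = ((2:ℕ):ℝ) * log (log x) := by norm_num
      rw [this, Real.exp_nat_mul, Real.exp_log hl]
    rw [h7, ← Real.exp_add, Real.norm_eq_abs, abs_of_nonneg (sq_nonneg _)]
    unfold stU
    rw [mul_pow, ← Real.exp_nat_mul]
    have h8 := Real.sin_sq_le_one (stPsi θ ρ x)
    refine (mul_le_of_le_one_right (Real.exp_pos _).le h8).trans ?_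
    apply Real.exp_le_exp.2
    push_cast
    rw [h2]
    linarith
  · have hz : ρ =ᶠ[nhds 0] fun _ => 0 := by
      filter_upwards [Iio_mem_nhds (show (0:ℝ) < X + 1 by linarith)] with y hy
      exact hρz y (le_of_lt hy)
    have e1 : deriv ρ 0 = 0 := by rw [hz.deriv_eq]; simp
    have e2 : ρ 0 = 0 := hρz 0 (by linarith)
    have e3 : g 0 = 0 := hgz 0 (by linarith)
    have e4 : stPsi θ ρ 0 = π / 2 - θ := by simp [stPsi]
    rw [hUV]
    simp only [stV, stU, e1, e2, e3, e4, Real.cos_pi_div_two_sub, Real.sin_pi_div_two_sub]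
    simp
    ring
end

section
/- Let h : (0,∞) → (0,∞) be any function with h(x) → ∞ as x → ∞, let (θ_j)_{j≥1} ⊂ [0,π] be any sequence, and let (E_j)_{j≥1} be any sequence of distinct real numbers. Then there exists a function q ∈ C^∞([0,∞)) with |q(x)| ≤ h(x)/(1 + x^{1-α/2}) for all x > 0 such that, for every j, the perturbed Stark eigen-equation -u'' - x^α·u + q·u = E_j·u has an L²(ℝ⁺) solution u satisfying the boundary condition u'(0)·cos θ_j = u(0)·sin θ_j. -/
open Filter MeasureTheory Set Real

namespace StarkAux

lemma picard_global {V : Type*} [NormedAddCommGroup V] [NormedSpace ℝ V] [CompleteSpace V]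
    (F : ℝ → V → V) (y0 : V) (N L K : ℝ) (hN : 0 ≤ N) (hL : 0 ≤ L) (hK : 0 ≤ K)
    (hc : ∀ y, Continuous (fun t => F t y))
    (hb : ∀ t, |t| ≤ N → ∀ y, ‖F t y‖ ≤ L)
    (hl : ∀ t, |t| ≤ N → ∀ y z, ‖F t y - F t z‖ ≤ K * ‖y - z‖) :
    ∃ y : ℝ → V, y 0 = y0 ∧ ∀ t, |t| < N → HasDerivAt y (F t (y t)) t := by
  have h0 : (0:ℝ) ∈ Icc (-N) N := ⟨by linarith, hN⟩
  have hp : IsPicardLindelof F (tmin := -N) (tmax := N) ⟨0, h0⟩ y0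
      ⟨L * N, by positivity⟩ 0 ⟨L, hL⟩ ⟨K, hK⟩ := by
    refine ⟨?_, ?_, ?_, ?_⟩
    · intro t ht
      refine LipschitzOnWith.of_dist_le_mul ?_
      intro y _ z _
      rw [dist_eq_norm, dist_eq_norm]
      exact hl t (abs_le.2 ht) y z
    · intro y _
      exact (hc y).continuousOn
    · intro t ht y _
      exact hb t (abs_le.2 ht) y
    · simp; rfl
  obtain ⟨y, hy0, hy⟩ := hp.exists_eq_forall_mem_Icc_hasDerivWithinAt₀
  refine ⟨y, hy0, fun t ht => ?_⟩
  have := abs_lt.1 ht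
  exact (hy t ⟨this.1.le, this.2.le⟩).hasDerivAt (Icc_mem_nhds this.1 this.2)

/-- the finite vector field -/
noncomputable def fld (A B : ℕ → ℝ → ℝ → ℝ) (e : ℕ → ℝ → ℝ) (n : ℕ) (t : ℝ) (y : Fin n → ℝ) : Fin n → ℝ :=
  fun i => A i t (y i) + B i t (y i) * ∑ l : Fin n, e l t * sin (2 * y l)

lemma fld_bounds (A B : ℕ → ℝ → ℝ → ℝ) (e : ℕ → ℝ → ℝ)
    (hA : ∀ i N : ℕ, ∃ L : ℝ, ∀ t : ℝ, |t| ≤ N → ∀ y z : ℝ, |A i t y| ≤ L ∧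
      |A i t y - A i t z| ≤ L * |y - z|)
    (hB : ∀ i N : ℕ, ∃ L : ℝ, ∀ t : ℝ, |t| ≤ N → ∀ y z : ℝ, |B i t y| ≤ L ∧
      |B i t y - B i t z| ≤ L * |y - z|)
    (he : ∀ i, Continuous (e i)) (n : ℕ) :
    ∃ L K : ℝ, 0 ≤ L ∧ 0 ≤ K ∧ (∀ t : ℝ, |t| ≤ n → ∀ y, ‖fld A B e n t y‖ ≤ L) ∧
      (∀ t : ℝ, |t| ≤ n → ∀ y z, ‖fld A B e n t y - fld A B e n t z‖ ≤ K * ‖y - z‖) := by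
  have he' : ∀ i : ℕ, ∃ L : ℝ, ∀ t : ℝ, |t| ≤ n → |e i t| ≤ L := by
    intro i
    obtain ⟨L, hL⟩ := (isCompact_Icc (a := -(n:ℝ)) (b := n)).exists_bound_of_continuousOn
      (he i).continuousOn
    exact ⟨L, fun t ht => hL t (abs_le.1 ht)⟩
  choose LA hLA using fun i => hA i n
  choose LB hLB using fun i => hB i n
  choose Le hLe using he'
  obtain ⟨Λ, hΛ⟩ : ∃ Λ : ℝ, 0 ≤ Λ ∧ ∀ i : Fin n, LA i ≤ Λ ∧ LB i ≤ Λ ∧ Le i ≤ Λ := by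
    refine ⟨∑ i : Fin n, (|LA i| + |LB i| + |Le i|), by positivity, fun i => ?_⟩
    have := Finset.single_le_sum (f := fun i : Fin n => (|LA i| + |LB i| + |Le i|))
      (fun i _ => by positivity) (Finset.mem_univ i)
    have h1 := le_abs_self (LA i)
    have h2 := le_abs_self (LB i)
    have h3 := le_abs_self (Le i)
    have h1 := abs_nonneg (LA i)
    have h2 := abs_nonneg (LB i)
    have h3 := abs_nonneg (Le i)
    refine ⟨?_, ?_, ?_⟩ <;> linarith
  obtain ⟨hΛ0, hΛ⟩ := hΛ
  have hS : ∀ t : ℝ, |t| ≤ n → ∀ y : Fin n → ℝ, |∑ l : Fin n, e l t * sin (2 * y l)| ≤ n * Λ := by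
    intro t ht y
    refine (Finset.abs_sum_le_sum_abs _ _).trans ?_
    have : ∀ l ∈ (Finset.univ : Finset (Fin n)), |e l t * sin (2 * y l)| ≤ Λ := by
      intro l _
      rw [abs_mul]
      have h1 := (hLe l t ht).trans (hΛ l).2.2
      have h2 := abs_sin_le_one (2 * y l)
      nlinarith [abs_nonneg (e l t), abs_nonneg (sin (2 * y l))]
    simpa using Finset.sum_le_card_nsmul _ _ _ this
  have hSd : ∀ t : ℝ, |t| ≤ n → ∀ y z : Fin n → ℝ, |∑ l : Fin n, e l t * sin (2 * y l) -
      ∑ l : Fin n, e l t * sin (2 * z l)| ≤ n * (Λ * (2 * ‖y - z‖)) := by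
    intro t ht y z
    rw [← Finset.sum_sub_distrib]
    refine (Finset.abs_sum_le_sum_abs _ _).trans ?_
    have : ∀ l ∈ (Finset.univ : Finset (Fin n)),
        |e l t * sin (2 * y l) - e l t * sin (2 * z l)| ≤ Λ * (2 * ‖y - z‖) := by
      intro l _
      rw [← mul_sub, abs_mul]
      have h1 := (hLe l t ht).trans (hΛ l).2.2
      have h2 : |sin (2 * y l) - sin (2 * z l)| ≤ 2 * ‖y - z‖ := by
        have h3 := abs_sin_sub_sin_le (2 * y l) (2 * z l)
        have h4 := norm_le_pi_norm (y - z) l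
        rw [Pi.sub_apply, Real.norm_eq_abs] at h4
        rw [← mul_sub, abs_mul, abs_two] at h3
        linarith
      gcongr
    simpa using Finset.sum_le_card_nsmul _ _ _ this
  refine ⟨Λ + Λ * (n * Λ), Λ + Λ * (n * Λ) + Λ * (n * (Λ * 2)), by positivity, by positivity, ?_, ?_⟩
  · intro t ht y
    rw [pi_norm_le_iff_of_nonneg (by positivity)]
    intro i
    rw [Real.norm_eq_abs]
    unfold fld
    refine (abs_add_le _ _).trans ?_
    rw [abs_mul]
    have h1 := ((hLA i t ht (y i) (y i)).1).trans (hΛ i).1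
    have h2 := ((hLB i t ht (y i) (y i)).1).trans (hΛ i).2.1
    have h3 := hS t ht y
    gcongr
  · intro t ht y z
    rw [pi_norm_le_iff_of_nonneg (by positivity)]
    intro i
    rw [Real.norm_eq_abs, Pi.sub_apply]
    unfold fld
    have hd : |y i - z i| ≤ ‖y - z‖ := norm_le_pi_norm (y - z) i
    have h1 : |A i t (y i) - A i t (z i)| ≤ Λ * ‖y - z‖ := by
      refine (hLA i t ht (y i) (z i)).2.trans ?_
      exact mul_le_mul (hΛ i).1 hd (abs_nonneg _) hΛ0
    have h2 : |B i t (y i) - B i t (z i)| ≤ Λ * ‖y - z‖ := by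
      refine (hLB i t ht (y i) (z i)).2.trans ?_
      exact mul_le_mul (hΛ i).2.1 hd (abs_nonneg _) hΛ0
    have h3 := ((hLB i t ht (z i) (z i)).1).trans (hΛ i).2.1
    have h4 := hS t ht y
    have h5 := hSd t ht y z
    set S1 := ∑ l : Fin n, e l t * sin (2 * y l)
    set S2 := ∑ l : Fin n, e l t * sin (2 * z l)
    have : A i t (y i) + B i t (y i) * S1 - (A i t (z i) + B i t (z i) * S2)
      = (A i t (y i) - A i t (z i)) + (B i t (y i) - B i t (z i)) * S1
        + B i t (z i) * (S1 - S2) := by ring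
    rw [this]
    calc _ ≤ |A i t (y i) - A i t (z i)| + |B i t (y i) - B i t (z i)| * |S1|
        + |B i t (z i)| * |S1 - S2| := by
          refine (abs_add_le _ _).trans ?_
          rw [abs_mul (B i t (z i))]
          gcongr
          refine (abs_add_le _ _).trans ?_
          rw [abs_mul]
      _ ≤ Λ * ‖y - z‖ + (Λ * ‖y - z‖) * (n * Λ) + Λ * (n * (Λ * (2 * ‖y - z‖))) := by
          gcongr
      _ = _ := by ring

theorem system_exists (A B : ℕ → ℝ → ℝ → ℝ) (e : ℕ → ℝ → ℝ) (y0 : ℕ → ℝ)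
    (hA : ∀ i N : ℕ, ∃ L : ℝ, ∀ t : ℝ, |t| ≤ N → ∀ y z : ℝ, |A i t y| ≤ L ∧
      |A i t y - A i t z| ≤ L * |y - z|)
    (hB : ∀ i N : ℕ, ∃ L : ℝ, ∀ t : ℝ, |t| ≤ N → ∀ y z : ℝ, |B i t y| ≤ L ∧
      |B i t y - B i t z| ≤ L * |y - z|)
    (hAc : ∀ i y, Continuous (fun t => A i t y))
    (hBc : ∀ i y, Continuous (fun t => B i t y))
    (he : ∀ i, Continuous (e i))
    (he0 : ∀ (i : ℕ) (t : ℝ), t ≤ i → e i t = 0) :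
    ∃ φ : ℕ → ℝ → ℝ, (∀ i, φ i 0 = y0 i) ∧ ∀ (i n : ℕ) (t : ℝ), |t| < n →
      HasDerivAt (φ i) (A i t (φ i t) + B i t (φ i t) *
        ∑ l ∈ Finset.range n, e l t * sin (2 * φ l t)) t := by
  choose L K hL hK hLb hKb using fld_bounds A B e hA hB he
  have hex : ∀ n : ℕ, ∃ y : ℝ → (Fin n → ℝ), y 0 = (fun i : Fin n => y0 i) ∧
      ∀ t : ℝ, |t| < n → HasDerivAt y (fld A B e n t (y t)) t := by
    intro n
    refine picard_global (fld A B e n) _ n (L n) (K n) (by positivity) (hL n) (hK n) ?_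
      (hLb n) (hKb n)
    intro y
    refine continuous_pi fun i => ?_
    unfold fld
    exact (hAc _ _).add ((hBc _ _).mul (continuous_finsetSum _ fun l _ => (he l).mul continuous_const))
  choose Y hY0 hY using hex
  have hstep : ∀ n : ℕ, ∀ t : ℝ, |t| < n → (fun i : Fin n => Y (n+1) t i.castSucc) = Y n t := by
    intro n t ht
    have hn : (0:ℝ) < n := (abs_nonneg t).trans_lt ht
    have := ODE_solution_unique_of_mem_Ioo (v := fld A B e n) (s := fun _ => univ)
      (K := ⟨K n, hK n⟩) (a := -(n:ℝ)) (b := n) (t₀ := 0)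
      (f := fun t => fun i : Fin n => Y (n+1) t i.castSucc) (g := Y n) ?_ ⟨by linarith, hn⟩ ?_ ?_ ?_
    · exact this (abs_lt.1 ht)
    · intro s hs
      refine LipschitzOnWith.of_dist_le_mul ?_
      intro y _ z _
      rw [dist_eq_norm, dist_eq_norm]
      exact hKb n s (abs_le.2 ⟨hs.1.le, hs.2.le⟩) y z
    · intro s hs
      refine ⟨?_, trivial⟩
      rw [hasDerivAt_pi]
      intro i
      have h1 := hY (n+1) s ((abs_lt.2 hs).trans (by push_cast; linarith))
      rw [hasDerivAt_pi] at h1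
      have h2 := h1 i.castSucc
      convert h2 using 1
      unfold fld
      rw [Fin.sum_univ_castSucc]
      simp [he0 n s hs.2.le]
    · intro s hs
      exact ⟨hY n s (abs_lt.2 hs), trivial⟩
    · rw [hY0]
      funext i
      simp [hY0]
  let Z : ℕ → ℕ → ℝ → ℝ := fun n i t => if h : i < n then Y n t ⟨i, h⟩ else 0
  have hZs : ∀ (n i : ℕ) (t : ℝ), i < n → |t| < n → Z (n+1) i t = Z n i t := by
    intro n i t hi ht
    have := congrFun (hstep n t ht) ⟨i, hi⟩
    simp only [Z, dif_pos hi, dif_pos (show i < n + 1 by omega)]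
    exact this
  have hZm : ∀ (i : ℕ) (t : ℝ) (n m : ℕ), i < n → |t| < n → n ≤ m → Z m i t = Z n i t := by
    intro i t n m hi ht hnm
    induction m, hnm using Nat.le_induction with
    | base => rfl
    | succ m hm ih =>
      rw [hZs m i t (by omega) (ht.trans_le (by exact_mod_cast hm)), ih]
  let φ : ℕ → ℝ → ℝ := fun i t => Z (i + ⌊|t|⌋₊ + 1) i t
  have hφ : ∀ (i : ℕ) (t : ℝ) (m : ℕ), i < m → |t| < m → φ i t = Z m i t := by
    intro i t m hi ht
    have h1 : |t| < ((i + ⌊|t|⌋₊ + 1 : ℕ) : ℝ) := by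
      have := Nat.lt_floor_add_one |t|
      push_cast
      have h0 : (0:ℝ) ≤ i := by positivity
      linarith
    rcases le_total m (i + ⌊|t|⌋₊ + 1) with h | h
    · exact hZm i t _ _ hi ht h
    · exact (hZm i t _ _ (by omega) h1 h).symm
  refine ⟨φ, ?_, ?_⟩
  · intro i
    rw [hφ i 0 (i+1) (by omega) (by simp; positivity)]
    simp [Z, hY0]
  · intro i n t ht
    obtain ⟨m, hmi, hmn⟩ : ∃ m : ℕ, i < m ∧ n ≤ m := ⟨max (i+1) n, by omega, by omega⟩
    have htm : |t| < m := ht.trans_le (by exact_mod_cast hmn)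
    have h1 := hY m t htm
    rw [hasDerivAt_pi] at h1
    have h2 := h1 ⟨i, hmi⟩
    have h3 : φ i =ᶠ[nhds t] fun s => Y m s ⟨i, hmi⟩ := by
      have : ∀ᶠ s : ℝ in nhds t, |s| < m := (continuous_abs.tendsto t).eventually_lt_const htm
      filter_upwards [this] with s hs
      rw [hφ i s m hmi hs]
      simp [Z, hmi]
    refine (h2.congr_of_eventuallyEq h3).congr_deriv ?_
    have h4 : ∑ l ∈ Finset.range n, e l t * sin (2 * φ l t)
        = ∑ l ∈ Finset.range m, e l t * sin (2 * φ l t) := by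
      refine Finset.sum_subset (Finset.range_mono hmn) ?_
      intro l _ hl
      rw [he0 l t, zero_mul]
      have : n ≤ l := by simpa using hl
      exact ((le_abs_self t).trans ht.le).trans (by exact_mod_cast this)
    rw [h4, ← Fin.sum_univ_eq_sum_range (fun l => e l t * sin (2 * φ l t)) m]
    unfold fld
    have h5 : ∀ l : Fin m, φ l t = Y m t l := by
      intro l
      rw [hφ l t m l.2 htm]
      simp [Z]
    simp only [h5]
    rw [hφ i t m hmi htm]
    simp [Z, hmi]

end StarkAux

namespace StarkAux

theorem prufer (k P q φ : ℝ → ℝ) (hk : ContDiff ℝ 1 k) (hk1 : ∀ x, 1 ≤ k x) (hk0 : k 0 = 1)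
    (hP : Continuous P) (hq : Continuous q)
    (hφ : ∀ x, HasDerivAt φ (k x * cos (φ x) ^ 2 + ((P x - q x) / k x) * sin (φ x) ^ 2
      + (deriv k x / (2 * k x)) * sin (2 * φ x)) x) :
    ∃ ℓ u : ℝ → ℝ, (∀ x, HasDerivAt ℓ (-(deriv k x / (2 * k x)) * cos (2 * φ x)
        + (k x - (P x - q x) / k x) / 2 * sin (2 * φ x)) x) ∧
      ContDiff ℝ 2 u ∧ (∀ x, u x ^ 2 ≤ exp (2 * ℓ x)) ∧
      (∀ x, deriv (deriv u) x = (q x - P x) * u x) ∧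
      u 0 = sin (φ 0) ∧ deriv u 0 = cos (φ 0) := by
  have hkpos : ∀ x, 0 < k x := fun x => by linarith [hk1 x]
  have hkne : ∀ x, k x ≠ 0 := fun x => (hkpos x).ne'
  have hkc : Continuous k := hk.continuous
  have hkdc : Continuous (deriv k) := hk.continuous_deriv (le_refl _)
  have hkd : ∀ x, HasDerivAt k (deriv k x) x := fun x =>
    (hk.differentiable (by norm_num) x).hasDerivAt
  have hφc : Continuous φ := continuous_iff_continuousAt.2 fun x => (hφ x).continuousAt
  set f : ℝ → ℝ := fun x => -(deriv k x / (2 * k x)) * cos (2 * φ x)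
        + (k x - (P x - q x) / k x) / 2 * sin (2 * φ x) with hf
  have hfc : Continuous f := by
    have : ∀ x, 2 * k x ≠ 0 := fun x => by have := hkpos x; positivity
    rw [hf]
    fun_prop (disch := assumption)
  let ℓ : ℝ → ℝ := fun x => ∫ t in (0:ℝ)..x, f t
  have hℓ : ∀ x, HasDerivAt ℓ (f x) x := fun x =>
    intervalIntegral.integral_hasDerivAt_right (hfc.intervalIntegrable _ _)
      (hfc.stronglyMeasurableAtFilter _ _) hfc.continuousAt
  let u : ℝ → ℝ := fun x => (√(k x))⁻¹ * exp (ℓ x) * sin (φ x)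
  let v : ℝ → ℝ := fun x => √(k x) * exp (ℓ x) * cos (φ x)
  have hs : ∀ x, HasDerivAt (fun x => √(k x)) (deriv k x / (2 * k x) * √(k x)) x := by
    intro x
    refine ((hkd x).sqrt (hkne x)).congr_deriv ?_
    have h1 : √(k x) ≠ 0 := (sqrt_pos.2 (hkpos x)).ne'
    have h2 : √(k x) ^ 2 = k x := sq_sqrt (hkpos x).le
    rw [← h2]
    field_simp
    simp
  have hu : ∀ x, HasDerivAt u (v x) x := by
    intro x
    have h1 : √(k x) ≠ 0 := (sqrt_pos.2 (hkpos x)).ne'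
    have h2 : √(k x) * √(k x) = k x := mul_self_sqrt (hkpos x).le
    have h3 := (((hs x).inv h1).mul (hℓ x).exp).mul (hφ x).sin
    refine h3.congr_deriv ?_
    simp only [v, hf, sin_two_mul, cos_two_mul', Pi.mul_apply, Pi.inv_apply]
    generalize deriv k x / (2 * k x) = p
    generalize (P x - q x) / k x = m
    have h4 : k x = √(k x) * √(k x) := h2.symm
    generalize √(k x) = s at *
    rw [h4]
    have h5 := sin_sq_add_cos_sq (φ x)
    generalize sin (φ x) = S at *
    generalize cos (φ x) = C at *
    generalize exp (ℓ x) = e at *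
    field_simp
    linear_combination (s^2 * C + p * S) * e * h5
  have hv : ∀ x, HasDerivAt v ((q x - P x) * u x) x := by
    intro x
    have h1 : √(k x) ≠ 0 := (sqrt_pos.2 (hkpos x)).ne'
    have h2 : √(k x) * √(k x) = k x := mul_self_sqrt (hkpos x).le
    have h3 := ((hs x).mul (hℓ x).exp).mul (hφ x).cos
    refine h3.congr_deriv ?_
    simp only [u, hf, sin_two_mul, cos_two_mul', Pi.mul_apply]
    generalize deriv k x / (2 * k x) = p
    have h6 : q x - P x = - ((P x - q x) / k x) * k x := by
      field_simp [hkne x]; ring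
    rw [h6]
    generalize (P x - q x) / k x = m
    have h4 : k x = √(k x) * √(k x) := h2.symm
    generalize √(k x) = s at *
    rw [h4]
    have h5 := sin_sq_add_cos_sq (φ x)
    generalize sin (φ x) = S at *
    generalize cos (φ x) = C at *
    generalize exp (ℓ x) = e at *
    field_simp
    linear_combination (- m * S - p * C) * e * h5
  have hdu : deriv u = v := funext fun x => (hu x).deriv
  have hdv : deriv v = fun x => (q x - P x) * u x := funext fun x => (hv x).deriv
  have huc : Continuous u := continuous_iff_continuousAt.2 fun x => (hu x).continuousAt
  refine ⟨ℓ, u, hℓ, ?_, ?_, ?_, ?_, ?_⟩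
  · have : (2 : WithTop ℕ∞) = 1 + 1 := by norm_num
    rw [this, contDiff_succ_iff_deriv]
    refine ⟨fun x => (hu x).differentiableAt, by simp, ?_⟩
    rw [hdu, contDiff_one_iff_deriv]
    refine ⟨fun x => (hv x).differentiableAt, ?_⟩
    rw [hdv]
    fun_prop
  · intro x
    have h1 : 1 ≤ √(k x) := one_le_sqrt.2 (hk1 x)
    have h3 : (√(k x))⁻¹ ^ 2 ≤ 1 := by
      have := inv_le_one_of_one_le₀ h1
      exact pow_le_one₀ (by positivity) this
    have h2 : sin (φ x) ^ 2 ≤ 1 := sin_sq_le_one _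
    have h4 : exp (2 * ℓ x) = exp (ℓ x) ^ 2 := by rw [← exp_nat_mul]; norm_num
    simp only [u]
    rw [h4, mul_pow, mul_pow]
    have h5 : 0 ≤ exp (ℓ x) ^ 2 := by positivity
    calc _ ≤ 1 * exp (ℓ x) ^ 2 * 1 := by gcongr
      _ = _ := by ring
  · intro x
    rw [hdu, hdv]
  · simp [u, ℓ, hk0]
  · rw [hdu]
    simp [v, ℓ, hk0]

end StarkAux

namespace StarkAux
open Asymptotics

lemma exists_k (α E : ℝ) (hα : 0 < α) : ∃ k : ℝ → ℝ, ContDiff ℝ (⊤ : ℕ∞) k ∧ (∀ x, 1 ≤ k x) ∧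
    k 0 = 1 ∧ ∀ᶠ x in atTop, k x ^ 2 = x ^ α + E := by
  have h1 : ∀ᶠ x : ℝ in atTop, 1 - E ≤ x ^ α := (tendsto_rpow_atTop hα).eventually_ge_atTop _
  obtain ⟨Z0, hZ0⟩ := eventually_atTop.1 h1
  obtain ⟨Z, hZ1, hZ⟩ : ∃ Z : ℝ, 1 ≤ Z ∧ ∀ x, Z ≤ x → 1 - E ≤ x ^ α :=
    ⟨max 1 Z0, le_max_left _ _, fun x hx => hZ0 x ((le_max_right _ _).trans hx)⟩
  have hin : ∀ x, 1 ≤ 1 + smoothTransition (x - Z) * (x ^ α + E - 1) := by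
    intro x
    rcases le_total x Z with h | h
    · rw [smoothTransition.zero_of_nonpos (by linarith)]; simp
    · have := hZ x h
      have h3 := smoothTransition.nonneg (x - Z)
      nlinarith
  refine ⟨fun x => √(1 + smoothTransition (x - Z) * (x ^ α + E - 1)), ?_, ?_, ?_, ?_⟩
  · rw [contDiff_iff_contDiffAt]
    intro x
    rcases lt_or_ge x Z with h | h
    · have : (fun x => √(1 + smoothTransition (x - Z) * (x ^ α + E - 1))) =ᶠ[nhds x] fun _ => 1 := by
        filter_upwards [Iio_mem_nhds h] with y hy
        rw [smoothTransition.zero_of_nonpos (by linarith [mem_Iio.1 hy])]; simp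
      exact contDiffAt_const.congr_of_eventuallyEq this
    · refine ContDiffAt.sqrt ?_ (by linarith [hin x])
      have h2 : ContDiffAt ℝ (⊤ : ℕ∞) (fun x : ℝ => x ^ α) x :=
        contDiffAt_rpow_const_of_ne (by linarith)
      have h3 : ContDiffAt ℝ (⊤ : ℕ∞) (fun x : ℝ => smoothTransition (x - Z)) x :=
        (smoothTransition.contDiff.comp (contDiff_id.sub contDiff_const)).contDiffAt
      exact contDiffAt_const.add (h3.mul ((h2.add contDiffAt_const).sub contDiffAt_const))
  · intro x
    exact one_le_sqrt.2 (hin x)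
  · simp [smoothTransition.zero_of_nonpos (show -Z ≤ 0 by linarith)]
  · filter_upwards [eventually_ge_atTop (Z + 1)] with x hx
    rw [sq_sqrt (by linarith [hin x]), smoothTransition.one_of_one_le (by linarith)]
    ring

/-- symbol-type functions of order `p` -/
def Tame (f : ℝ → ℝ) (p : ℝ) : Prop :=
  (∀ᶠ x in atTop, DifferentiableAt ℝ f x) ∧ f =O[atTop] (fun x : ℝ => x ^ p) ∧
    deriv f =O[atTop] (fun x : ℝ => x ^ (p - 1))

lemma Tame.congr_exp {f : ℝ → ℝ} {p q : ℝ} (h : Tame f p) (hpq : p = q) : Tame f q := hpq ▸ h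

lemma rpow_isBigO {p q : ℝ} (h : p ≤ q) :
    (fun x : ℝ => x ^ p) =O[atTop] (fun x : ℝ => x ^ q) := by
  refine IsBigO.of_bound 1 ?_
  filter_upwards [eventually_ge_atTop 1] with x hx
  rw [norm_of_nonneg (by positivity), norm_of_nonneg (by positivity), one_mul]
  exact rpow_le_rpow_of_exponent_le hx h

lemma Tame.mono {f : ℝ → ℝ} {p q : ℝ} (h : Tame f p) (hpq : p ≤ q) : Tame f q :=
  ⟨h.1, h.2.1.trans (rpow_isBigO hpq), h.2.2.trans (rpow_isBigO (by linarith))⟩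

lemma rpow_mul_ev (p q : ℝ) :
    (fun x : ℝ => x ^ p * x ^ q) =ᶠ[atTop] (fun x : ℝ => x ^ (p + q)) := by
  filter_upwards [eventually_gt_atTop 0] with x hx
  rw [rpow_add hx]

lemma isBigO_mul {f g : ℝ → ℝ} {p q r : ℝ} (hf : f =O[atTop] (fun x : ℝ => x ^ p))
    (hg : g =O[atTop] (fun x : ℝ => x ^ q)) (h : p + q = r) :
    (fun x => f x * g x) =O[atTop] (fun x : ℝ => x ^ r) := by
  subst h
  exact (hf.mul hg).trans_eventuallyEq (rpow_mul_ev p q)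

lemma Tame.mul {f g : ℝ → ℝ} {p q : ℝ} (hf : Tame f p) (hg : Tame g q) :
    Tame (fun x => f x * g x) (p + q) := by
  refine ⟨?_, isBigO_mul hf.2.1 hg.2.1 rfl, ?_⟩
  · filter_upwards [hf.1, hg.1] with x h1 h2 using h1.mul h2
  · have : deriv (fun x => f x * g x) =ᶠ[atTop] fun x => deriv f x * g x + f x * deriv g x := by
      filter_upwards [hf.1, hg.1] with x h1 h2
      exact (h1.hasDerivAt.mul h2.hasDerivAt).deriv
    refine this.trans_isBigO ?_
    exact (isBigO_mul hf.2.2 hg.2.1 (by ring)).add (isBigO_mul hf.2.1 hg.2.2 (by ring))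

lemma Tame.add {f g : ℝ → ℝ} {p : ℝ} (hf : Tame f p) (hg : Tame g p) :
    Tame (fun x => f x + g x) p := by
  refine ⟨?_, hf.2.1.add hg.2.1, ?_⟩
  · filter_upwards [hf.1, hg.1] with x h1 h2 using h1.add h2
  · have : deriv (fun x => f x + g x) =ᶠ[atTop] fun x => deriv f x + deriv g x := by
      filter_upwards [hf.1, hg.1] with x h1 h2
      exact (h1.hasDerivAt.add h2.hasDerivAt).deriv
    exact this.trans_isBigO (hf.2.2.add hg.2.2)

lemma Tame.const_mul {f : ℝ → ℝ} {p : ℝ} (c : ℝ) (hf : Tame f p) :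
    Tame (fun x => c * f x) p := by
  refine ⟨?_, hf.2.1.const_mul_left c, ?_⟩
  · filter_upwards [hf.1] with x h1 using h1.const_mul c
  · have : deriv (fun x => c * f x) =ᶠ[atTop] fun x => c * deriv f x := by
      filter_upwards [hf.1] with x h1
      exact (h1.hasDerivAt.const_mul c).deriv
    exact this.trans_isBigO (hf.2.2.const_mul_left c)

lemma Tame.inv {f : ℝ → ℝ} {p c : ℝ} (hc : 0 < c) (hf : Tame f p)
    (hl : ∀ᶠ x in atTop, c * x ^ p ≤ f x) : Tame (fun x => (f x)⁻¹) (-p) := by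
  have hpos : ∀ᶠ x in atTop, 0 < f x := by
    filter_upwards [hl, eventually_gt_atTop 0] with x h1 h2
    exact lt_of_lt_of_le (by positivity) h1
  have hO : (fun x => (f x)⁻¹) =O[atTop] (fun x : ℝ => x ^ (-p)) := by
    refine IsBigO.of_bound c⁻¹ ?_
    filter_upwards [hl, hpos, eventually_gt_atTop 0] with x h1 h2 h3
    rw [norm_of_nonneg (by positivity), norm_of_nonneg (by positivity), rpow_neg h3.le,
      ← mul_inv]
    exact inv_anti₀ (by positivity) h1
  refine ⟨?_, hO, ?_⟩
  · filter_upwards [hf.1, hpos] with x h1 h2 using h1.inv h2.ne'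
  · have : deriv (fun x => (f x)⁻¹) =ᶠ[atTop] fun x => (-1) * (deriv f x * ((f x)⁻¹ * (f x)⁻¹)) := by
      filter_upwards [hf.1, hpos] with x h1 h2
      have := (h1.hasDerivAt.inv h2.ne').deriv
      refine Eq.trans this ?_
      field_simp
    refine this.trans_isBigO ?_
    refine IsBigO.const_mul_left ?_ _
    exact isBigO_mul hf.2.2 (isBigO_mul hO hO rfl) (by ring)

lemma tame_rpow (p : ℝ) : Tame (fun x : ℝ => x ^ p) p := by
  refine ⟨?_, isBigO_refl _ _, ?_⟩
  · filter_upwards [eventually_gt_atTop 0] with x hx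
    exact (hasDerivAt_rpow_const (Or.inl hx.ne')).differentiableAt
  · have : deriv (fun x : ℝ => x ^ p) =ᶠ[atTop] fun x => p * x ^ (p - 1) := by
      filter_upwards [eventually_gt_atTop 0] with x hx
      exact (hasDerivAt_rpow_const (Or.inl hx.ne')).deriv
    exact this.trans_isBigO ((isBigO_refl _ _).const_mul_left p)

section
variable {α E : ℝ} {k : ℝ → ℝ}

lemma k_le (hα : 0 < α) (hk1 : ∀ x, 1 ≤ k x) (hk : ∀ᶠ x in atTop, k x ^ 2 = x ^ α + E) :
    ∀ᶠ x in atTop, (1/2) * x ^ (α/2) ≤ k x ∧ k x ≤ 2 * x ^ (α/2) := by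
  have h1 : ∀ᶠ x : ℝ in atTop, 2 * |E| ≤ x ^ α := (tendsto_rpow_atTop hα).eventually_ge_atTop _
  filter_upwards [h1, hk, eventually_gt_atTop 0] with x h1 h2 h3
  have h4 : x ^ α = (x ^ (α/2)) ^ 2 := by
    rw [← rpow_natCast, ← rpow_mul h3.le]; norm_num
  have h5 : 0 < x ^ (α/2) := by positivity
  have h6 := hk1 x
  have h7 := abs_le.1 (le_refl |E|)
  constructor
  · refine abs_le_of_sq_le_sq' ?_ (by linarith) |>.2
    nlinarith
  · refine abs_le_of_sq_le_sq' ?_ (by linarith) |>.2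
    nlinarith

lemma k_deriv (hkd : Differentiable ℝ k) (hk1 : ∀ x, 1 ≤ k x)
    (hk : ∀ᶠ x in atTop, k x ^ 2 = x ^ α + E) :
    ∀ᶠ x in atTop, deriv k x = (α / 2) * (x ^ (α - 1) * (k x)⁻¹) := by
  obtain ⟨X, hX⟩ := eventually_atTop.1 hk
  filter_upwards [eventually_gt_atTop X, eventually_gt_atTop 0] with x h1 h2
  have h3 : HasDerivAt (fun x => k x ^ 2) (2 * k x * deriv k x) x := by
    exact ((hkd x).hasDerivAt.pow 2).congr_deriv (by simp)
  have h4 : HasDerivAt (fun x : ℝ => x ^ α + E) (α * x ^ (α - 1)) x :=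
    (hasDerivAt_rpow_const (Or.inl h2.ne')).add_const E
  have h5 : (fun x => k x ^ 2) =ᶠ[nhds x] (fun x : ℝ => x ^ α + E) := by
    filter_upwards [Ioi_mem_nhds h1] with y hy using hX y (le_of_lt hy)
  have h6 := h3.unique (h4.congr_of_eventuallyEq h5)
  have h7 : k x ≠ 0 := by linarith [hk1 x]
  field_simp
  linarith

lemma tame_k (hα : 0 < α) (hkd : Differentiable ℝ k) (hk1 : ∀ x, 1 ≤ k x)
    (hk : ∀ᶠ x in atTop, k x ^ 2 = x ^ α + E) :
    Tame k (α/2) ∧ Tame (fun x => (k x)⁻¹) (-(α/2)) := by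
  have hle := k_le hα hk1 hk
  have hinv : (fun x => (k x)⁻¹) =O[atTop] (fun x : ℝ => x ^ (-(α/2))) := by
    refine IsBigO.of_bound 2 ?_
    filter_upwards [hle, eventually_gt_atTop 0] with x h1 h3
    have h2 := hk1 x
    rw [norm_of_nonneg (by positivity), norm_of_nonneg (by positivity), rpow_neg h3.le]
    have h5 : 0 < x ^ (α/2) := by positivity
    have := inv_anti₀ (by positivity) h1.1
    rw [mul_inv] at this
    linarith
  have ht : Tame k (α/2) := by
    refine ⟨Eventually.of_forall hkd, ?_, ?_⟩
    · refine IsBigO.of_bound 2 ?_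
      filter_upwards [hle, eventually_gt_atTop 0] with x h1 h3
      have h2 := hk1 x
      rw [norm_of_nonneg (by positivity), norm_of_nonneg (by positivity)]
      exact h1.2
    · have := k_deriv hkd hk1 hk
      refine EventuallyEq.trans_isBigO this ?_
      exact (isBigO_mul (isBigO_refl _ _) hinv (by ring)).const_mul_left _
  exact ⟨ht, ht.inv (c := 1/2) (by norm_num) (hle.mono fun x h => h.1)⟩

end

lemma Tame.exists_bound {f : ℝ → ℝ} {p : ℝ} (h : Tame f p) : ∃ M X : ℝ, 0 ≤ M ∧ 1 ≤ X ∧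
    ∀ x, X ≤ x → HasDerivAt f (deriv f x) x ∧ |f x| ≤ M * x ^ p ∧ |deriv f x| ≤ M * x ^ (p - 1) := by
  obtain ⟨c1, hc1, h1⟩ := h.2.1.exists_nonneg
  obtain ⟨c2, hc2, h2⟩ := h.2.2.exists_nonneg
  obtain ⟨X, hX⟩ := eventually_atTop.1 ((h.1.and h1.bound).and h2.bound)
  refine ⟨c1 + c2, max 1 X, by positivity, le_max_left _ _, fun x hx => ?_⟩
  have hx1 : 1 ≤ x := (le_max_left _ _).trans hx
  obtain ⟨⟨h3, h4⟩, h5⟩ := hX x ((le_max_right _ _).trans hx)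
  rw [norm_eq_abs, norm_of_nonneg (by positivity)] at h4 h5
  refine ⟨h3.hasDerivAt, h4.trans ?_, h5.trans ?_⟩
  · gcongr; linarith
  · gcongr; linarith

end StarkAux

namespace StarkAux
open Asymptotics

lemma osc {δ K R T x ω r g' : ℝ} {g ψ : ℝ → ℝ} (hδ : 0 < δ) (hT : 1 ≤ T) (hx : T ≤ x)
    (hK : 0 ≤ K)
    (hg : HasDerivAt g g' x) (hψ : HasDerivAt ψ (ω + r) x)
    (hr : |r| ≤ R * x ^ (δ - 1))
    (h1 : |g x| ≤ K * x ^ (-δ))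
    (h2 : |g'| + |g x| * (R * x ^ (δ - 1)) ≤ K * δ * x ^ (-δ - 1)) :
    ∃ G', HasDerivAt (fun y => g y * sin (ψ y) + K * (2 * T ^ (-δ) - y ^ (-δ))) G' x ∧
      g x * ω * cos (ψ x) ≤ G' ∧
      0 ≤ g x * sin (ψ x) + K * (2 * T ^ (-δ) - x ^ (-δ)) ∧
      g x * sin (ψ x) + K * (2 * T ^ (-δ) - x ^ (-δ)) ≤ 3 * K * T ^ (-δ) := by
  have hx0 : 0 < x := by linarith
  have hT0 : 0 < T := by linarith
  have h3 : HasDerivAt (fun y : ℝ => y ^ (-δ)) (-δ * x ^ (-δ - 1)) x :=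
    hasDerivAt_rpow_const (Or.inl hx0.ne')
  have h4 := (hg.mul hψ.sin).add ((h3.const_sub (2 * T ^ (-δ))).const_mul K)
  refine ⟨_, h4, ?_, ?_, ?_⟩
  · have a1 : |g' * sin (ψ x)| ≤ |g'| := by
      rw [abs_mul]
      exact mul_le_of_le_one_right (abs_nonneg _) (abs_sin_le_one _)
    have a2 : |g x * (cos (ψ x) * r)| ≤ |g x| * (R * x ^ (δ - 1)) := by
      rw [abs_mul, abs_mul]
      have : |cos (ψ x)| * |r| ≤ 1 * (R * x ^ (δ - 1)) := by
        have := abs_cos_le_one (ψ x)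
        gcongr
      rw [one_mul] at this
      gcongr
    have b1 := (abs_le.1 a1).1
    have b2 := (abs_le.1 a2).1
    have : g' * sin (ψ x) + g x * (cos (ψ x) * (ω + r)) + K * -(-δ * x ^ (-δ - 1))
      = g x * ω * cos (ψ x) + (g' * sin (ψ x) + g x * (cos (ψ x) * r) + K * δ * x ^ (-δ - 1)) := by ring
    rw [this]
    linarith
  all_goals
    have a1 : |g x * sin (ψ x)| ≤ K * x ^ (-δ) := by
      rw [abs_mul]
      exact (mul_le_of_le_one_right (abs_nonneg _) (abs_sin_le_one _)).trans h1
    have a2 : x ^ (-δ) ≤ T ^ (-δ) := rpow_le_rpow_of_nonpos hT0 hx (by linarith)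
    have b1 := abs_le.1 a1
    have b2 : K * x ^ (-δ) ≤ K * T ^ (-δ) := by gcongr
    have b3 : 0 ≤ K * x ^ (-δ) := by positivity
    linarith

lemma osc_chi {δ K R T x ω r : ℝ} {g ψ : ℝ → ℝ} (hδ : 0 < δ) (hT : 1 ≤ T)
    (hK : 0 ≤ K)
    (hb : T ≤ x → HasDerivAt g (deriv g x) x ∧ HasDerivAt ψ (ω + r) x ∧ |r| ≤ R * x ^ (δ - 1) ∧
      |g x| ≤ K * x ^ (-δ) ∧
      |deriv g x| + |g x| * (R * x ^ (δ - 1)) ≤ K * δ * x ^ (-δ - 1)) :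
    ∃ H', HasDerivAt (fun y => smoothTransition (y - T) *
        (g y * sin (ψ y) + K * (2 * T ^ (-δ) - y ^ (-δ)))) H' x ∧
      smoothTransition (x - T) * (g x * ω * cos (ψ x)) ≤ H' ∧
      0 ≤ smoothTransition (x - T) * (g x * sin (ψ x) + K * (2 * T ^ (-δ) - x ^ (-δ))) ∧
      smoothTransition (x - T) * (g x * sin (ψ x) + K * (2 * T ^ (-δ) - x ^ (-δ)))
        ≤ 3 * K * T ^ (-δ) := by
  have hc0 := smoothTransition.nonneg (x - T)
  have hc1 := smoothTransition.le_one (x - T)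
  have hT0 : 0 < T := by linarith
  rcases lt_or_ge x T with hx | hx
  · refine ⟨0, ?_, ?_⟩
    · have : (fun y => smoothTransition (y - T) *
        (g y * sin (ψ y) + K * (2 * T ^ (-δ) - y ^ (-δ)))) =ᶠ[nhds x] fun _ => 0 := by
        filter_upwards [Iio_mem_nhds hx] with y hy
        rw [smoothTransition.zero_of_nonpos (by linarith [mem_Iio.1 hy]), zero_mul]
      exact (hasDerivAt_const x (0:ℝ)).congr_of_eventuallyEq this
    · rw [smoothTransition.zero_of_nonpos (by linarith)]
      simp only [zero_mul, le_refl, true_and]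
      positivity
  · obtain ⟨hg, hψ, hr, h1, h2⟩ := hb hx
    obtain ⟨G', hG, hGle, hG0, hG3⟩ := osc hδ hT hx hK hg hψ hr h1 h2
    have hχ : HasDerivAt (fun y => smoothTransition (y - T)) (deriv smoothTransition (x - T)) x := by
      have : DifferentiableAt ℝ smoothTransition (x - T) :=
        (smoothTransition.contDiff (n := 1)).differentiable (by norm_num) _
      exact this.hasDerivAt.comp_sub_const x T
    have hχ0 : 0 ≤ deriv smoothTransition (x - T) := smoothTransition.monotone.deriv_nonneg
    refine ⟨_, hχ.mul hG, ?_, mul_nonneg hc0 hG0, ?_⟩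
    · have a1 := mul_nonneg hχ0 hG0
      have a2 := mul_le_mul_of_nonneg_left hGle hc0
      linarith
    · exact (mul_le_of_le_one_left hG0 hc1).trans hG3

lemma tame_osc {δ R : ℝ} {g : ℝ → ℝ} (hδ : 0 < δ) (hR : 0 ≤ R) (hg : Tame g (-(2 * δ))) :
    ∃ K X : ℝ, 0 ≤ K ∧ 1 ≤ X ∧ ∀ x, X ≤ x → HasDerivAt g (deriv g x) x ∧
      |g x| ≤ K * x ^ (-δ) ∧ |deriv g x| + |g x| * (R * x ^ (δ - 1)) ≤ K * δ * x ^ (-δ - 1) := by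
  obtain ⟨M, X, hM, hX, h⟩ := hg.exists_bound
  refine ⟨M + (M + M * R) / δ, X, by positivity, hX, fun x hx => ?_⟩
  obtain ⟨h1, h2, h3⟩ := h x hx
  have hx1 : 1 ≤ x := hX.trans hx
  have hx0 : 0 < x := by linarith
  refine ⟨h1, h2.trans ?_, ?_⟩
  · have a1 : x ^ (-(2 * δ)) ≤ x ^ (-δ) := rpow_le_rpow_of_exponent_le hx1 (by linarith)
    have a2 : 0 ≤ (M + M * R) / δ := by positivity
    gcongr
    linarith
  · have a1 : x ^ (-(2 * δ) - 1) ≤ x ^ (-δ - 1) := rpow_le_rpow_of_exponent_le hx1 (by linarith)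
    have a2 : x ^ (-(2 * δ)) * x ^ (δ - 1) = x ^ (-δ - 1) := by
      rw [← rpow_add hx0]; congr 1; ring
    have a3 : |g x| * (R * x ^ (δ - 1)) ≤ M * R * x ^ (-δ - 1) := by
      calc _ ≤ (M * x ^ (-(2 * δ))) * (R * x ^ (δ - 1)) := by gcongr
        _ = M * R * (x ^ (-(2 * δ)) * x ^ (δ - 1)) := by ring
        _ = _ := by rw [a2]
    have a4 : |deriv g x| ≤ M * x ^ (-δ - 1) := h3.trans (by gcongr)
    have a5 : (M + (M + M * R) / δ) * δ * x ^ (-δ - 1)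
      = M * δ * x ^ (-δ - 1) + (M * x ^ (-δ - 1) + M * R * x ^ (-δ - 1)) := by
      field_simp
    rw [a5]
    have : 0 ≤ M * δ * x ^ (-δ - 1) := by positivity
    linarith

section
variable {α δ E E' : ℝ} {k k' : ℝ → ℝ}

/-- bound of the phase error -/
lemma phase_bound (hα : 0 < α) (hδ : 0 < δ) (hαδ : α / 2 = 1 - 2 * δ)
    (hkd : Differentiable ℝ k) (hk1 : ∀ x, 1 ≤ k x)
    (hk : ∀ᶠ x in atTop, k x ^ 2 = x ^ α + E) :
    ∃ R X : ℝ, 0 ≤ R ∧ 1 ≤ X ∧ ∀ x, X ≤ x → (∀ w : ℝ, |w| ≤ 8 * x ^ (-δ) →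
      |w| / k x + |deriv k x / (2 * k x)| ≤ R * x ^ (δ - 1)) ∧ k x ^ 2 = x ^ α + E ∧
      k x ≤ 2 * x ^ (α / 2) ∧ deriv k x = (α / 2) * (x ^ (α - 1) * (k x)⁻¹) := by
  obtain ⟨h1, h2⟩ := tame_k hα hkd hk1 hk
  obtain ⟨M1, X1, hM1, hX1, hb1⟩ := h1.exists_bound
  obtain ⟨M2, X2, hM2, hX2, hb2⟩ := h2.exists_bound
  obtain ⟨X3, hX3⟩ := eventually_atTop.1 (hk.and ((k_le hα hk1 hk).and (k_deriv hkd hk1 hk)))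
  refine ⟨8 * M2 + M1 * M2, max X1 (max X2 X3), by positivity, hX1.trans (le_max_left _ _), ?_⟩
  intro x hx
  have hxX1 : X1 ≤ x := (le_max_left _ _).trans hx
  have hxX2 : X2 ≤ x := (le_max_left _ _).trans ((le_max_right _ _).trans hx)
  have hxX3 : X3 ≤ x := (le_max_right _ _).trans ((le_max_right _ _).trans hx)
  obtain ⟨h3, h4, h5⟩ := hX3 x hxX3
  refine ⟨?_, h3, h4.2, h5⟩
  intro w hw
  have hx1 : 1 ≤ x := hX1.trans hxX1
  have hx0 : 0 < x := by linarith
  have hk0 : 0 < k x := by linarith [hk1 x]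
  obtain ⟨_, _, b1⟩ := hb1 x hxX1
  obtain ⟨_, b2, _⟩ := hb2 x hxX2
  rw [abs_of_pos (by positivity)] at b2
  have c1 : |w| / k x ≤ 8 * M2 * x ^ (δ - 1) := by
    rw [div_eq_mul_inv]
    calc _ ≤ (8 * x ^ (-δ)) * (M2 * x ^ (-(α / 2))) := by gcongr
      _ = 8 * M2 * (x ^ (-δ) * x ^ (-(α / 2))) := by ring
      _ = _ := by
        rw [← rpow_add hx0]; congr 2; linarith
  have c2 : |deriv k x / (2 * k x)| ≤ M1 * M2 * x ^ (δ - 1) := by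
    rw [abs_div, abs_of_pos (show 0 < 2 * k x by positivity)]
    calc _ ≤ |deriv k x| * (k x)⁻¹ := by
          rw [div_eq_mul_inv]
          gcongr
          linarith
      _ ≤ (M1 * x ^ (α / 2 - 1)) * (M2 * x ^ (-(α / 2))) := by gcongr
      _ = M1 * M2 * (x ^ (α / 2 - 1) * x ^ (-(α / 2))) := by ring
      _ ≤ _ := by
        rw [← rpow_add hx0]
        gcongr
        linarith
  calc _ ≤ _ := add_le_add c1 c2
    _ = _ := by ring

lemma tame_g4 (hα : 0 < α) (c : ℝ)
    (hkd : Differentiable ℝ k) (hk1 : ∀ x, 1 ≤ k x)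
    (hk : ∀ᶠ x in atTop, k x ^ 2 = x ^ α + E)
    (hkd' : Differentiable ℝ k') (hk1' : ∀ x, 1 ≤ k' x)
    (hk' : ∀ᶠ x in atTop, k' x ^ 2 = x ^ α + E') :
    Tame (fun x => c * (x ^ (α / 2 - 1) * ((k x + k' x) * (k' x)⁻¹))) (α / 2 - 1) := by
  obtain ⟨h1, h2⟩ := tame_k hα hkd hk1 hk
  obtain ⟨h1', h2'⟩ := tame_k hα hkd' hk1' hk'
  exact (((tame_rpow _).mul ((h1.add h1').mul h2')).congr_exp (by ring)).const_mul c

lemma tame_g3 (hα : 0 < α) (c : ℝ)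
    (hkd : Differentiable ℝ k) (hk1 : ∀ x, 1 ≤ k x)
    (hk : ∀ᶠ x in atTop, k x ^ 2 = x ^ α + E)
    (hkd' : Differentiable ℝ k') (hk1' : ∀ x, 1 ≤ k' x)
    (hk' : ∀ᶠ x in atTop, k' x ^ 2 = x ^ α + E') :
    Tame (fun x => c * (x ^ (α / 2 - 1) * ((k x + k' x)⁻¹ * (k' x)⁻¹))) (α / 2 - 1) := by
  obtain ⟨h1, h2⟩ := tame_k hα hkd hk1 hk
  obtain ⟨h1', h2'⟩ := tame_k hα hkd' hk1' hk'
  have h3 := (h1.add h1').inv (c := 1/2) (by norm_num) (by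
    filter_upwards [k_le hα hk1 hk] with x hx
    linarith [hk1' x])
  exact (((tame_rpow (α / 2 - 1)).mul (h3.mul h2')).mono (by linarith)).const_mul c

lemma tame_g2 (hα : 0 < α) (c : ℝ)
    (hkd : Differentiable ℝ k) (hk1 : ∀ x, 1 ≤ k x)
    (hk : ∀ᶠ x in atTop, k x ^ 2 = x ^ α + E) :
    Tame (fun x => c * (x ^ (α - 1) * ((k x)⁻¹ * ((k x)⁻¹ * (k x)⁻¹)))) (α / 2 - 1) := by
  obtain ⟨h1, h2⟩ := tame_k hα hkd hk1 hk
  exact (((tame_rpow (α - 1)).mul (h2.mul (h2.mul h2))).mono (by linarith)).const_mul c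

end

end StarkAux

namespace StarkAux
open Asymptotics

/-- conclusion of `tame_osc` -/
def Osc (δ R K X : ℝ) (g : ℝ → ℝ) : Prop :=
  0 ≤ K ∧ 1 ≤ X ∧ ∀ x, X ≤ x → HasDerivAt g (deriv g x) x ∧
      |g x| ≤ K * x ^ (-δ) ∧ |deriv g x| + |g x| * (R * x ^ (δ - 1)) ≤ K * δ * x ^ (-δ - 1)

/-- conclusion of `phase_bound` -/
def Ph (α δ E R X : ℝ) (k : ℝ → ℝ) : Prop :=
  0 ≤ R ∧ 1 ≤ X ∧ ∀ x, X ≤ x → (∀ w : ℝ, |w| ≤ 8 * x ^ (-δ) →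
      |w| / k x + |deriv k x / (2 * k x)| ≤ R * x ^ (δ - 1)) ∧ k x ^ 2 = x ^ α + E ∧
      k x ≤ 2 * x ^ (α / 2) ∧ deriv k x = (α / 2) * (x ^ (α - 1) * (k x)⁻¹)

/-- the Prüfer angle equation -/
def Ang (α E : ℝ) (k q φ : ℝ → ℝ) : Prop :=
  ∀ x, HasDerivAt φ (k x * cos (φ x) ^ 2 + ((|x| ^ α + E - q x) / k x) * sin (φ x) ^ 2
      + (deriv k x / (2 * k x)) * sin (2 * φ x)) x

lemma Ang.phase {α δ E R X : ℝ} {k q φ : ℝ → ℝ} (h : Ang α E k q φ) (hp : Ph α δ E R X k)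
    (hk1 : ∀ x, 1 ≤ k x) (hq : ∀ x, 1 ≤ x → |q x| ≤ 8 * x ^ (-δ)) {x : ℝ} (hx : X ≤ x) :
    ∃ r, HasDerivAt φ (k x + r) x ∧ |r| ≤ R * x ^ (δ - 1) := by
  obtain ⟨hR, hX, hp⟩ := hp
  obtain ⟨h1, h2, _, _⟩ := hp x hx
  have hx1 : 1 ≤ x := hX.trans hx
  have hk0 : 0 < k x := by linarith [hk1 x]
  refine ⟨-(q x / k x) * sin (φ x) ^ 2 + (deriv k x / (2 * k x)) * sin (2 * φ x), ?_, ?_⟩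
  · refine (h x).congr_deriv ?_
    rw [abs_of_pos (by linarith), ← h2]
    have h5 := sin_sq_add_cos_sq (φ x)
    have : (k x ^ 2 - q x) / k x = k x - q x / k x := by field_simp
    rw [this]
    linear_combination k x * h5
  · refine le_trans ?_ (h1 (q x) (hq x hx1))
    refine (abs_add_le _ _).trans ?_
    rw [abs_mul, abs_mul, abs_neg, abs_div, abs_of_pos hk0]
    refine add_le_add ?_ ?_
    · refine mul_le_of_le_one_right (by positivity) ?_
      rw [abs_of_nonneg (by positivity)]
      exact sin_sq_le_one _
    · exact mul_le_of_le_one_right (by positivity) (abs_sin_le_one _)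

/-- amplitude functions -/
noncomputable def g3 (α : ℝ) (k k' : ℝ → ℝ) : ℝ → ℝ :=
  fun x => 1 * (x ^ (α / 2 - 1) * ((k x + k' x)⁻¹ * (k' x)⁻¹))
noncomputable def g4 (α c : ℝ) (k k' : ℝ → ℝ) : ℝ → ℝ :=
  fun x => c * (x ^ (α / 2 - 1) * ((k x + k' x) * (k' x)⁻¹))
noncomputable def g2 (α : ℝ) (k : ℝ → ℝ) : ℝ → ℝ :=
  fun x => (-(α / 8)) * (x ^ (α - 1) * ((k x)⁻¹ * ((k x)⁻¹ * (k x)⁻¹)))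

/-- corrector -/
noncomputable def HH (δ K T : ℝ) (g ψ : ℝ → ℝ) : ℝ → ℝ :=
  fun y => smoothTransition (y - T) * (g y * sin (ψ y) + K * (2 * T ^ (-δ) - y ^ (-δ)))

lemma step_ne {α δ Ei Ej Ri Rj Xi Xj K3 X3 K4 X4 T y : ℝ} {ki kj q φi φj : ℝ → ℝ}
    (hδ : 0 < δ)
    (hki : ∀ x, 1 ≤ ki x) (hkj : ∀ x, 1 ≤ kj x)
    (hpi : Ph α δ Ei Ri Xi ki) (hpj : Ph α δ Ej Rj Xj kj)
    (hq : ∀ x, 1 ≤ x → |q x| ≤ 8 * x ^ (-δ))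
    (hi : Ang α Ei ki q φi) (hj : Ang α Ej kj q φj)
    (h3 : Osc δ (2 * (Ri + Rj)) K3 X3 (g3 α ki kj))
    (h4 : Osc δ (2 * (Ri + Rj)) K4 X4 (g4 α (-(1 / (Ei - Ej))) ki kj))
    (hT : 1 ≤ T) (hy : T ≤ y → Xi ≤ y ∧ Xj ≤ y ∧ X3 ≤ y ∧ X4 ≤ y) :
    (∃ H', HasDerivAt (HH δ K3 T (g3 α ki kj) (fun x => 2 * (φi x + φj x))) H' y ∧
      smoothTransition (y - T) * (2 * y ^ (α / 2 - 1) / kj y * cos (2 * (φi y + φj y))) ≤ H' ∧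
      0 ≤ HH δ K3 T (g3 α ki kj) (fun x => 2 * (φi x + φj x)) y ∧
      HH δ K3 T (g3 α ki kj) (fun x => 2 * (φi x + φj x)) y ≤ 3 * K3 * T ^ (-δ)) ∧
    (∃ H', HasDerivAt (HH δ K4 T (g4 α (-(1 / (Ei - Ej))) ki kj)
        (fun x => 2 * (φi x - φj x))) H' y ∧
      (Ei ≠ Ej → smoothTransition (y - T) * (- (2 * y ^ (α / 2 - 1) / kj y * cos (2 * (φi y - φj y)))) ≤ H') ∧
      0 ≤ HH δ K4 T (g4 α (-(1 / (Ei - Ej))) ki kj) (fun x => 2 * (φi x - φj x)) y ∧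
      HH δ K4 T (g4 α (-(1 / (Ei - Ej))) ki kj) (fun x => 2 * (φi x - φj x)) y
        ≤ 3 * K4 * T ^ (-δ)) := by
  have hi0 : 0 < ki y := by linarith [hki y]
  have hj0 : 0 < kj y := by linarith [hkj y]
  have hr : ∃ ri rj : ℝ, T ≤ y → HasDerivAt φi (ki y + ri) y ∧ |ri| ≤ Ri * y ^ (δ - 1) ∧
      HasDerivAt φj (kj y + rj) y ∧ |rj| ≤ Rj * y ^ (δ - 1) := by
    by_cases h : T ≤ y
    · obtain ⟨a1, a2, a3, a4⟩ := hy h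
      obtain ⟨ri, b1, b2⟩ := hi.phase hpi hki hq a1
      obtain ⟨rj, c1, c2⟩ := hj.phase hpj hkj hq a2
      exact ⟨ri, rj, fun _ => ⟨b1, b2, c1, c2⟩⟩
    · exact ⟨0, 0, fun h' => absurd h' h⟩
  obtain ⟨ri, rj, hr⟩ := hr
  obtain ⟨hK3, hX3, h3⟩ := h3
  obtain ⟨hK4, hX4, h4⟩ := h4
  constructor
  · have := osc_chi (x := y) (ω := 2 * (ki y + kj y)) (r := 2 * (ri + rj))
      (g := g3 α ki kj) (ψ := fun x => 2 * (φi x + φj x)) (R := 2 * (Ri + Rj)) hδ hT hK3 ?_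
    · obtain ⟨H', b1, b2, b3⟩ := this
      refine ⟨H', b1, ?_, b3⟩
      refine le_trans (le_of_eq ?_) b2
      simp only [g3]
      field_simp
    · intro h
      obtain ⟨a1, a2, a3, a4⟩ := hy h
      obtain ⟨b1, b2, b3, b4⟩ := hr h
      obtain ⟨c1, c2, c3⟩ := h3 y a3
      refine ⟨c1, ?_, ?_, c2, c3⟩
      · exact ((b1.add b3).const_mul 2).congr_deriv (by ring)
      · rw [abs_mul, abs_two]
        have := abs_add_le ri rj
        nlinarith
  · have := osc_chi (x := y) (ω := 2 * (ki y - kj y)) (r := 2 * (ri - rj))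
      (g := g4 α (-(1 / (Ei - Ej))) ki kj) (ψ := fun x => 2 * (φi x - φj x))
      (R := 2 * (Ri + Rj)) hδ hT hK4 ?_
    · obtain ⟨H', b1, b2, b3⟩ := this
      refine ⟨H', b1, fun hE => ?_, b3⟩
      refine le_trans (le_of_eq ?_) b2
      rcases lt_or_ge y T with h | h
      · rw [smoothTransition.zero_of_nonpos (by linarith)]; simp
      obtain ⟨a1, a2, a3, a4⟩ := hy h
      have d1 := (hpi.2.2 y a1).2.1
      have d2 := (hpj.2.2 y a2).2.1
      have d3 : (ki y - kj y) * (ki y + kj y) = Ei - Ej := by linear_combination d1 - d2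
      have d4 : Ei - Ej ≠ 0 := sub_ne_zero.2 hE
      simp only [g4]
      congr 1
      have : -(1 / (Ei - Ej)) * (y ^ (α / 2 - 1) * ((ki y + kj y) * (kj y)⁻¹)) *
          (2 * (ki y - kj y)) * cos (2 * (φi y - φj y))
        = -(1 / (Ei - Ej)) * ((ki y - kj y) * (ki y + kj y)) * (y ^ (α / 2 - 1) * (kj y)⁻¹ * 2 *
          cos (2 * (φi y - φj y))) := by ring
      rw [this, d3]
      field_simp
    · intro h
      obtain ⟨a1, a2, a3, a4⟩ := hy h
      obtain ⟨b1, b2, b3, b4⟩ := hr h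
      obtain ⟨c1, c2, c3⟩ := h4 y a4
      refine ⟨c1, ?_, ?_, c2, c3⟩
      · exact ((b1.sub b3).const_mul 2).congr_deriv (by ring)
      · rw [abs_mul, abs_two]
        have := abs_sub ri rj
        nlinarith

end StarkAux

namespace StarkAux
open Asymptotics

section
variable {α δ : ℝ} {E R X T : ℕ → ℝ} {K3 X3 K4 X4 : ℕ → ℕ → ℝ} {k φ : ℕ → ℝ → ℝ} {q : ℝ → ℝ}

/-- combined corrector -/
noncomputable def CC (α δ : ℝ) (E T : ℕ → ℝ) (K3 K4 : ℕ → ℕ → ℝ) (k φ : ℕ → ℝ → ℝ) (i j : ℕ) :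
    ℝ → ℝ :=
  fun y => HH δ (K3 i j) (T i) (g3 α (k i) (k j)) (fun x => 2 * (φ i x + φ j x)) y +
    (if i = j then 0 else HH δ (K4 i j) (T i) (g4 α (-(1 / (E i - E j))) (k i) (k j))
        (fun x => 2 * (φ i x - φ j x)) y)

lemma step_all (hδ : 0 < δ) (hE : Function.Injective E)
    (hk1 : ∀ i x, 1 ≤ k i x)
    (hp : ∀ i, Ph α δ (E i) (R i) (X i) (k i))
    (hq : ∀ x, 1 ≤ x → |q x| ≤ 8 * x ^ (-δ))
    (hA : ∀ i, Ang α (E i) (k i) q (φ i))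
    (h3 : ∀ i j, Osc δ (2 * (R i + R j)) (K3 i j) (X3 i j) (g3 α (k i) (k j)))
    (h4 : ∀ i j, Osc δ (2 * (R i + R j)) (K4 i j) (X4 i j)
      (g4 α (-(1 / (E i - E j))) (k i) (k j)))
    (hT1 : ∀ i, 1 ≤ T i) (i j : ℕ) {y : ℝ}
    (hy : T i ≤ y → X i ≤ y ∧ X j ≤ y ∧ X3 i j ≤ y ∧ X4 i j ≤ y) (hyj : T j + 1 ≤ y) :
    ∃ H', HasDerivAt (CC α δ E T K3 K4 k φ i j) H' y ∧
      smoothTransition (y - T i) * (2 * y ^ (α / 2 - 1) / k j y) *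
        (cos (2 * (φ i y + φ j y)) - cos (2 * (φ i y - φ j y))) + (if i = j then 1 / y else 0) ≤ H' ∧
      0 ≤ CC α δ E T K3 K4 k φ i j y ∧
      CC α δ E T K3 K4 k φ i j y ≤ 3 * (K3 i j + K4 i j) * T i ^ (-δ) := by
  obtain ⟨⟨H3, a1, a2, a3, a4⟩, ⟨H4, b1, b2, b3, b4⟩⟩ := step_ne hδ (hk1 i) (hk1 j) (hp i) (hp j) hq
    (hA i) (hA j) (h3 i j) (h4 i j) (hT1 i) hy
  have hK4 := (h4 i j).1
  have hT0 : 0 < T i := by linarith [hT1 i]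
  by_cases hij : i = j
  · have hC : CC α δ E T K3 K4 k φ i j =
        HH δ (K3 i j) (T i) (g3 α (k i) (k j)) (fun x => 2 * (φ i x + φ j x)) := by
      funext y; simp [CC, hij]
    rw [hC]
    refine ⟨H3, a1, ?_, a3, a4.trans ?_⟩
    · have hy0 : 0 < y := by linarith [hT1 j]
      have h2 := ((hp j).2.2 y (hy (by rw [hij]; linarith)).2.1).2.2.1
      have hk0 : 0 < k j y := by linarith [hk1 j y]
      have h5 : 1 / y ≤ 2 * y ^ (α / 2 - 1) / k j y := by
        rw [rpow_sub_one hy0.ne', div_le_div_iff₀ hy0 hk0]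
        field_simp
        linarith
      have h6 : smoothTransition (y - T i) = 1 :=
        smoothTransition.one_of_one_le (by rw [hij]; linarith)
      rw [h6] at a2 ⊢
      have h7 : cos (2 * (φ i y - φ j y)) = 1 := by rw [hij]; simp
      rw [h7, if_pos hij]
      linarith
    · have : 0 ≤ K4 i j * T i ^ (-δ) := by positivity
      linarith
  · have hC : CC α δ E T K3 K4 k φ i j = fun y =>
        HH δ (K3 i j) (T i) (g3 α (k i) (k j)) (fun x => 2 * (φ i x + φ j x)) y +
        HH δ (K4 i j) (T i) (g4 α (-(1 / (E i - E j))) (k i) (k j))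
        (fun x => 2 * (φ i x - φ j x)) y := by
      funext y; simp [CC, hij]
    rw [hC]
    refine ⟨H3 + H4, a1.add b1, ?_, add_nonneg a3 b3, ?_⟩
    · have := b2 (fun h => hij (hE h))
      rw [if_neg hij]
      linarith
    · linarith

lemma decay (hδ : 0 < δ) (hE : Function.Injective E)
    (hk1 : ∀ i x, 1 ≤ k i x)
    (hp : ∀ i, Ph α δ (E i) (R i) (X i) (k i))
    (hq : ∀ x, 1 ≤ x → |q x| ≤ 8 * x ^ (-δ))
    (hA : ∀ i, Ang α (E i) (k i) q (φ i))
    (h3 : ∀ i j, Osc δ (2 * (R i + R j)) (K3 i j) (X3 i j) (g3 α (k i) (k j)))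
    (h4 : ∀ i j, Osc δ (2 * (R i + R j)) (K4 i j) (X4 i j)
      (g4 α (-(1 / (E i - E j))) (k i) (k j)))
    (hT1 : ∀ i, 1 ≤ T i)
    (hTX : ∀ i j, j ≤ i → X i ≤ T i ∧ X j ≤ T i ∧ X3 i j ≤ T i ∧ X4 i j ≤ T i)
    (hTs : ∀ i j, j ≤ i → 3 * (K3 i j + K4 i j) * T i ^ (-δ) ≤ (1 / 2) ^ i)
    (hqs : ∀ (n : ℕ) (x : ℝ), |x| < n → q x = -∑ l ∈ Finset.range n,
      8 * smoothTransition (x - T l) * x ^ (α / 2 - 1) * sin (2 * φ l x))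
    (j : ℕ) {K2 X2 : ℝ} (h2 : Osc δ (2 * R j) K2 X2 (g2 α (k j))) {ℓ : ℝ → ℝ}
    (hℓ : ∀ x, HasDerivAt ℓ (-(deriv (k j) x/(2*k j x)) * cos (2*φ j x) +
      (k j x - (|x| ^ α + E j - q x)/k j x)/2 * sin (2*φ j x)) x) :
    ∃ D Y : ℝ, 1 ≤ Y ∧ ∀ x, Y ≤ x → ℓ x ≤ D - log x := by
  obtain ⟨Y, hY1, hY2, hY3, hY4⟩ : ∃ Y : ℝ, T j + 1 ≤ Y ∧ X2 ≤ Y ∧ X j ≤ Y ∧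
      ∀ i ∈ Finset.range (j + 1), X i ≤ Y ∧ X3 i j ≤ Y ∧ X4 i j ≤ Y := by
    refine Filter.Eventually.exists (f := atTop) ?_
    refine (eventually_ge_atTop _).and ((eventually_ge_atTop _).and ((eventually_ge_atTop _).and ?_))
    rw [Finset.eventually_all]
    exact fun i _ => (eventually_ge_atTop _).and ((eventually_ge_atTop _).and (eventually_ge_atTop _))
  have hYone : 1 ≤ Y := by linarith [hT1 j]
  have hstep : ∀ (i : ℕ) (y : ℝ), Y ≤ y → _ := fun i y hy => step_all hδ hE hk1 hp hq hA h3 h4 hT1 i j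
    (y := y) (fun hTi => by
      rcases le_total j i with h | h
      · obtain ⟨a1, a2, a3, a4⟩ := hTX i j h
        exact ⟨a1.trans hTi, a2.trans hTi, a3.trans hTi, a4.trans hTi⟩
      · obtain ⟨a1, a3, a4⟩ := hY4 i (Finset.mem_range.2 (by omega))
        exact ⟨a1.trans hy, hY3.trans hy, a3.trans hy, a4.trans hy⟩) (hY1.trans hy)
  set C := CC α δ E T K3 K4 k φ with hC
  set b : ℕ → ℝ := fun i => 3 * (K3 i j + K4 i j) * T i ^ (-δ) with hb
  have hb0 : ∀ i, 0 ≤ b i := fun i => by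
    have := (h3 i j).1
    have := (h4 i j).1
    have := hT1 i
    positivity
  have hbs : Summable b := by
    refine Summable.of_norm_bounded_eventually_nat (g := fun i : ℕ => (1 / 2 : ℝ) ^ i)
      summable_geometric_two ?_
    filter_upwards [eventually_ge_atTop j] with i hi
    rw [norm_of_nonneg (hb0 i)]
    exact hTs i j hi
  set G : ℝ → ℝ := fun y => g2 α (k j) y * sin (2 * φ j y) + K2 * (2 * Y ^ (-δ) - y ^ (-δ)) with hG
  have hGstep : ∀ y, Y ≤ y → ∃ G', HasDerivAt G G' y ∧
      -(deriv (k j) y/(2*k j y)) * cos (2*φ j y) ≤ G' ∧ 0 ≤ G y ∧ G y ≤ 3 * K2 * Y ^ (-δ) := by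
    intro y hy
    obtain ⟨r, hr1, hr2⟩ := (hA j).phase (hp j) (hk1 j) hq (hY3.trans hy)
    obtain ⟨c1, c2, c3⟩ := h2.2.2 y (hY2.trans hy)
    have := osc (ω := 2 * k j y) (r := 2 * r) (R := 2 * R j) (ψ := fun y => 2 * φ j y)
      hδ hYone hy h2.1 c1 ((hr1.const_mul 2).congr_deriv (by ring))
      (by rw [abs_mul, abs_two]; linarith) c2 c3
    obtain ⟨G', d1, d2, d3⟩ := this
    refine ⟨G', d1, le_trans (le_of_eq ?_) d2, d3⟩
    rw [((hp j).2.2 y (hY3.trans hy)).2.2.2]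
    have hk0 : 0 < k j y := by linarith [hk1 j y]
    simp only [g2]
    field_simp
    ring
  refine ⟨ℓ Y + log Y + 3 * K2 * Y ^ (-δ) + ∑' i, b i, Y, hYone, fun x hx => ?_⟩
  obtain ⟨n, hn⟩ : ∃ n : ℕ, max x j < n := exists_nat_gt _
  have hnx : x < n := (le_max_left _ _).trans_lt hn
  have hnj : j < n := by exact_mod_cast (le_max_right _ _).trans_lt hn
  set W : ℝ → ℝ := fun y => ℓ y + log y - G y - ∑ i ∈ Finset.range n, C i j y with hW
  have hWd : ∀ y ∈ Icc Y x, ∃ W', HasDerivAt W W' y ∧ W' ≤ 0 := by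
    intro y hy
    have hy0 : 0 < y := by linarith [hy.1]
    choose H' e1 e2 e3 e4 using fun i => hstep i y hy.1
    obtain ⟨G', f1, f2, f3, f4⟩ := hGstep y hy.1
    refine ⟨_, (((hℓ y).add (hasDerivAt_log hy0.ne')).sub f1).sub (HasDerivAt.fun_sum fun i _ => e1 i), ?_⟩
    have hsum := Finset.sum_le_sum fun i (_ : i ∈ Finset.range n) => e2 i
    rw [Finset.sum_add_distrib, Finset.sum_ite_eq' (Finset.range n) j,
      if_pos (Finset.mem_range.2 hnj)] at hsum
    have hkk := ((hp j).2.2 y (hY3.trans hy.1)).2.1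
    have hk0 : 0 < k j y := by linarith [hk1 j y]
    have key : (k j y - (|y| ^ α + E j - q y)/k j y)/2 * sin (2*φ j y) =
        ∑ i ∈ Finset.range n, smoothTransition (y - T i) * (2 * y ^ (α / 2 - 1) / k j y) *
        (cos (2 * (φ i y + φ j y)) - cos (2 * (φ i y - φ j y))) := by
      rw [abs_of_pos hy0, ← hkk]
      have : (k j y - (k j y ^ 2 - q y)/k j y)/2 = q y / (2 * k j y) := by field_simp; ring
      rw [this, hqs n y (by rw [abs_of_pos hy0]; linarith [hy.2]), ← Finset.sum_neg_distrib,
        Finset.sum_div, Finset.sum_mul]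
      refine Finset.sum_congr rfl fun i _ => ?_
      have : cos (2 * (φ i y + φ j y)) - cos (2 * (φ i y - φ j y)) =
          -2 * (sin (2 * φ i y) * sin (2 * φ j y)) := by
        rw [mul_add, mul_sub, cos_add, cos_sub]; ring
      rw [this]
      field_simp
      ring
    rw [key]
    rw [one_div] at hsum
    linarith
  have hanti : AntitoneOn W (Icc Y x) := by
    refine antitoneOn_of_deriv_nonpos (convex_Icc _ _) ?_ ?_ ?_
    · intro y hy
      obtain ⟨W', h, _⟩ := hWd y hy
      exact h.continuousAt.continuousWithinAt
    · intro y hy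
      obtain ⟨W', h, _⟩ := hWd y (interior_subset hy)
      exact h.differentiableAt.differentiableWithinAt
    · intro y hy
      obtain ⟨W', h, h'⟩ := hWd y (interior_subset hy)
      rw [h.deriv]; exact h'
  have hle := hanti (left_mem_Icc.2 hx) (right_mem_Icc.2 hx) hx
  simp only [hW] at hle
  have s1 : ∑ i ∈ Finset.range n, C i j x ≤ ∑' i, b i := by
    refine le_trans (Finset.sum_le_sum fun i _ => ?_) (hbs.sum_le_tsum _ fun i _ => hb0 i)
    obtain ⟨_, _, _, _, h⟩ := hstep i x hx
    exact h
  have s2 : 0 ≤ ∑ i ∈ Finset.range n, C i j Y := by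
    refine Finset.sum_nonneg fun i _ => ?_
    obtain ⟨_, _, _, h, _⟩ := hstep i Y le_rfl
    exact h
  obtain ⟨_, _, _, _, s3⟩ := hGstep x hx
  obtain ⟨_, _, _, s4, _⟩ := hGstep Y le_rfl
  linarith

end
end StarkAux

namespace StarkAux
open Asymptotics

/-- coupling functions -/
noncomputable def ee (α T : ℝ) : ℝ → ℝ := fun x => 8 * smoothTransition (x - T) * x ^ (α / 2 - 1)

lemma ee_zero {α T x : ℝ} (h : x ≤ T) : ee α T x = 0 := by
  simp [ee, smoothTransition.zero_of_nonpos (show x - T ≤ 0 by linarith)]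

lemma ee_smooth {α T : ℝ} (hT : 1 ≤ T) : ContDiff ℝ (⊤ : ℕ∞) (ee α T) := by
  rw [contDiff_iff_contDiffAt]
  intro x
  rcases lt_or_ge x 1 with hx | hx
  · have : ee α T =ᶠ[nhds x] fun _ => 0 := by
      filter_upwards [Iio_mem_nhds hx] with y hy
      exact ee_zero (by linarith [mem_Iio.1 hy])
    exact contDiffAt_const.congr_of_eventuallyEq this
  · have h1 : ContDiffAt ℝ (⊤ : ℕ∞) (fun x : ℝ => x ^ (α / 2 - 1)) x :=
      contDiffAt_rpow_const_of_ne (by linarith)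
    have h2 : ContDiff ℝ (⊤ : ℕ∞) (fun x : ℝ => smoothTransition (x - T)) :=
      smoothTransition.contDiff.comp (contDiff_id.sub contDiff_const)
    exact (contDiffAt_const.mul h2.contDiffAt).mul h1

lemma coef_bound {f1 f2 f3 : ℝ → ℝ} (h1 : Continuous f1) (h2 : Continuous f2) (h3 : Continuous f3)
    (N : ℕ) : ∃ L : ℝ, ∀ t : ℝ, |t| ≤ N → ∀ y z : ℝ,
      |f1 t * cos y ^ 2 + f2 t * sin y ^ 2 + f3 t * sin (2 * y)| ≤ L ∧
      |(f1 t * cos y ^ 2 + f2 t * sin y ^ 2 + f3 t * sin (2 * y)) -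
        (f1 t * cos z ^ 2 + f2 t * sin z ^ 2 + f3 t * sin (2 * z))| ≤ L * |y - z| := by
  have hb : ∀ f : ℝ → ℝ, Continuous f → ∃ C : ℝ, ∀ t : ℝ, |t| ≤ N → |f t| ≤ C := by
    intro f hf
    obtain ⟨C, hC⟩ := (isCompact_Icc (a := -(N:ℝ)) (b := N)).exists_bound_of_continuousOn hf.continuousOn
    exact ⟨C, fun t ht => hC t (abs_le.1 ht)⟩
  obtain ⟨C1, c1⟩ := hb f1 h1
  obtain ⟨C2, c2⟩ := hb f2 h2
  obtain ⟨C3, c3⟩ := hb f3 h3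
  refine ⟨2 * (C1 + C2 + C3), fun t ht y z => ?_⟩
  have d1 := c1 t ht
  have d2 := c2 t ht
  have d3 := c3 t ht
  have n1 := abs_nonneg (f1 t)
  have n2 := abs_nonneg (f2 t)
  have n3 := abs_nonneg (f3 t)
  constructor
  · refine (abs_add_three _ _ _).trans ?_
    rw [abs_mul, abs_mul, abs_mul]
    have e1 : |cos y ^ 2| ≤ 1 := by rw [abs_of_nonneg (by positivity)]; exact cos_sq_le_one _
    have e2 : |sin y ^ 2| ≤ 1 := by rw [abs_of_nonneg (by positivity)]; exact sin_sq_le_one _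
    have e3 := abs_sin_le_one (2 * y)
    have := mul_le_of_le_one_right n1 e1
    have := mul_le_of_le_one_right n2 e2
    have := mul_le_of_le_one_right n3 e3
    linarith
  · have : (f1 t * cos y ^ 2 + f2 t * sin y ^ 2 + f3 t * sin (2 * y)) -
        (f1 t * cos z ^ 2 + f2 t * sin z ^ 2 + f3 t * sin (2 * z)) =
        f1 t * ((cos (2 * y) - cos (2 * z)) / 2) + f2 t * (-((cos (2 * y) - cos (2 * z)) / 2)) +
        f3 t * (sin (2 * y) - sin (2 * z)) := by
      rw [sin_sq, sin_sq, cos_sq y, cos_sq z]; ring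
    rw [this]
    refine (abs_add_three _ _ _).trans ?_
    rw [abs_mul, abs_mul, abs_mul, abs_neg, abs_div, abs_two]
    have e1 := abs_cos_sub_cos_le (2 * y) (2 * z)
    have e2 := abs_sin_sub_sin_le (2 * y) (2 * z)
    rw [← mul_sub, abs_mul, abs_two] at e1 e2
    have m := abs_nonneg (y - z)
    have : |f1 t| * (|cos (2 * y) - cos (2 * z)| / 2) ≤ C1 * |y - z| :=
      mul_le_mul d1 (by linarith) (by positivity) (by linarith)
    have : |f2 t| * (|cos (2 * y) - cos (2 * z)| / 2) ≤ C2 * |y - z| :=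
      mul_le_mul d2 (by linarith) (by positivity) (by linarith)
    have : |f3 t| * |sin (2 * y) - sin (2 * z)| ≤ C3 * (2 * |y - z|) :=
      mul_le_mul d3 e2 (by positivity) (by linarith)
    have : 0 ≤ C1 * |y - z| := mul_nonneg (by linarith) m
    have : 0 ≤ C2 * |y - z| := mul_nonneg (by linarith) m
    linarith

section
variable {α δ : ℝ} {E T : ℕ → ℝ} {k φ : ℕ → ℝ → ℝ} {q : ℝ → ℝ}

lemma exists_sys (hα : 0 < α) (hk : ∀ i, ContDiff ℝ (⊤ : ℕ∞) (k i)) (hk1 : ∀ i x, 1 ≤ k i x)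
    (hT : ∀ i : ℕ, (i : ℝ) + 1 ≤ T i) (y0 : ℕ → ℝ) :
    ∃ (φ : ℕ → ℝ → ℝ) (q : ℝ → ℝ), (∀ i, φ i 0 = y0 i) ∧
      (∀ i, Ang α (E i) (k i) q (φ i)) ∧
      ∀ (n : ℕ) (x : ℝ), |x| < n → q x = -∑ l ∈ Finset.range n,
        ee α (T l) x * sin (2 * φ l x) := by
  have hkc : ∀ i, Continuous (k i) := fun i => (hk i).continuous
  have hkd : ∀ i, Continuous (deriv (k i)) := fun i => (hk i).continuous_deriv (by simp)
  have hk0 : ∀ i x, k i x ≠ 0 := fun i x => by linarith [hk1 i x]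
  have hk02 : ∀ i x, 2 * k i x ≠ 0 := fun i x => by linarith [hk1 i x]
  have hP : ∀ i, Continuous (fun t : ℝ => (|t| ^ α + E i) / k i t) := fun i =>
    ((continuous_abs.rpow_const (fun _ => Or.inr hα.le)).add continuous_const).div (hkc i) (hk0 i)
  have hD : ∀ i, Continuous (fun t : ℝ => deriv (k i) t / (2 * k i t)) := fun i =>
    (hkd i).div (continuous_const.mul (hkc i)) (hk02 i)
  have hI : ∀ i, Continuous (fun t : ℝ => 1 / k i t) := fun i =>
    continuous_const.div (hkc i) (hk0 i)
  have hT1 : ∀ i, 1 ≤ T i := fun i => by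
    have : (0:ℝ) ≤ i := Nat.cast_nonneg i
    linarith [hT i]
  obtain ⟨φ, h0, h⟩ := system_exists
    (fun i t y => k i t * cos y ^ 2 + ((|t| ^ α + E i) / k i t) * sin y ^ 2 +
      (deriv (k i) t / (2 * k i t)) * sin (2 * y))
    (fun i t y => 0 * cos y ^ 2 + (1 / k i t) * sin y ^ 2 + 0 * sin (2 * y))
    (fun i => ee α (T i)) y0
    (fun i N => coef_bound (hkc i) (hP i) (hD i) N)
    (fun i N => coef_bound (f1 := fun _ => 0) (f3 := fun _ => 0)
      continuous_const (hI i) continuous_const N)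
    (fun i y => (((hkc i).mul continuous_const).add ((hP i).mul continuous_const)).add
      ((hD i).mul continuous_const))
    (fun i y => ((continuous_const.mul continuous_const).add ((hI i).mul continuous_const)).add
      (continuous_const.mul continuous_const))
    (fun i => (ee_smooth (hT1 i)).continuous)
    (fun i t ht => ee_zero (by linarith [hT i]))
  refine ⟨φ, fun x => -∑ l ∈ Finset.range (⌊|x|⌋₊ + 1), ee α (T l) x * sin (2 * φ l x), h0, ?_, ?_⟩
  · intro i x
    have hx : |x| < ((⌊|x|⌋₊ + 1 : ℕ) : ℝ) := by push_cast; exact Nat.lt_floor_add_one _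
    refine (h i _ x hx).congr_deriv ?_
    ring
  · intro n x hx
    have hn : ⌊|x|⌋₊ + 1 ≤ n := by
      have := (Nat.floor_lt (abs_nonneg x)).2 hx
      omega
    simp only
    congr 1
    refine Finset.sum_subset (Finset.range_subset_range.2 hn) fun l _ hl => ?_
    have hl : ⌊|x|⌋₊ + 1 ≤ l := by simpa using hl
    rw [ee_zero, zero_mul]
    have h1 := (Nat.lt_floor_add_one |x|)
    have h2 : ((⌊|x|⌋₊ + 1 : ℕ) : ℝ) ≤ l := by exact_mod_cast hl
    push_cast at h2
    linarith [hT l, le_abs_self x]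

lemma q_smooth (hk : ∀ i, ContDiff ℝ (⊤ : ℕ∞) (k i)) (hk1 : ∀ i x, 1 ≤ k i x)
    (hA : ∀ i, Ang α (E i) (k i) q (φ i)) (hT : ∀ i, 1 ≤ T i)
    (hqs : ∀ (n : ℕ) (x : ℝ), |x| < n → q x = -∑ l ∈ Finset.range n,
        ee α (T l) x * sin (2 * φ l x)) : ContDiff ℝ (⊤ : ℕ∞) q := by
  have hloc : ∀ x : ℝ, ∃ n : ℕ, q =ᶠ[nhds x] fun y => -∑ l ∈ Finset.range n,
        ee α (T l) y * sin (2 * φ l y) := by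
    intro x
    obtain ⟨n, hn⟩ := exists_nat_gt |x|
    refine ⟨n, ?_⟩
    filter_upwards [(continuous_abs.tendsto x).eventually (gt_mem_nhds hn)] with y hy
    exact hqs n y hy
  have hqφ : ∀ m : ℕ, (∀ i, ContDiffOn ℝ m (φ i) (Ioi 0)) → ContDiffOn ℝ m q (Ioi 0) := by
    intro m hm x hx
    obtain ⟨n, hn⟩ := hloc x
    refine ContDiffAt.contDiffWithinAt ?_
    refine ContDiffAt.congr_of_eventuallyEq ?_ hn
    refine ContDiffAt.neg (ContDiffAt.sum fun l _ => ?_)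
    have h1 : ContDiffAt ℝ m (φ l) x := (hm l).contDiffAt (Ioi_mem_nhds hx)
    have h2 : ContDiffAt ℝ m (ee α (T l)) x := ((ee_smooth (hT l)).of_le (by exact_mod_cast le_top)).contDiffAt
    exact h2.mul (contDiffAt_const.mul h1).sin
  have hφ : ∀ m : ℕ, ∀ i, ContDiffOn ℝ m (φ i) (Ioi 0) := by
    intro m
    induction m with
    | zero =>
      intro i
      rw [Nat.cast_zero, contDiffOn_zero]
      exact fun x _ => (hA i x).continuousAt.continuousWithinAt
    | succ m ih =>
      intro i
      have hq := hqφ m ih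
      push_cast
      rw [contDiffOn_succ_iff_deriv_of_isOpen isOpen_Ioi]
      refine ⟨fun x _ => (hA i x).differentiableAt.differentiableWithinAt, by simp, ?_⟩
      have hkm : ContDiffOn ℝ m (k i) (Ioi 0) := ((hk i).of_le (by exact_mod_cast le_top)).contDiffOn
      have hkd : ContDiffOn ℝ m (deriv (k i)) (Ioi 0) :=
        ((contDiff_infty_iff_deriv.1 (hk i)).2.of_le (by exact_mod_cast le_top)).contDiffOn
      have hr : ContDiffOn ℝ m (fun x : ℝ => x ^ α) (Ioi 0) := fun x hx =>
        (contDiffAt_rpow_const_of_ne (ne_of_gt hx)).contDiffWithinAt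
      have hfin : ContDiffOn ℝ m (fun x => k i x * cos (φ i x) ^ 2 +
          ((x ^ α + E i - q x) / k i x) * sin (φ i x) ^ 2
          + (deriv (k i) x / (2 * k i x)) * sin (2 * φ i x)) (Ioi 0) := by
        refine ((hkm.mul ((ih i).cos.pow 2)).add ((ContDiffOn.div ((hr.add contDiffOn_const).sub hq)
          hkm ?_).mul ((ih i).sin.pow 2))).add ((hkd.div (contDiffOn_const.mul hkm) ?_).mul
          (contDiffOn_const.mul (ih i)).sin)
        · intro x _
          linarith [hk1 i x]
        · intro x _
          linarith [hk1 i x]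
      refine hfin.congr fun x hx => ?_
      rw [(hA i x).deriv, abs_of_pos hx]
  have hq : ContDiffOn ℝ (⊤ : ℕ∞) q (Ioi 0) := contDiffOn_infty.2 fun m => hqφ m (hφ m)
  rw [contDiff_iff_contDiffAt]
  intro x
  rcases lt_or_ge x 1 with hx | hx
  · obtain ⟨n, hn⟩ := hloc x
    have : q =ᶠ[nhds x] fun _ => 0 := by
      filter_upwards [Iio_mem_nhds hx, hn] with y hy hn
      rw [hn, Finset.sum_eq_zero, neg_zero]
      intro l _
      rw [ee_zero (by linarith [mem_Iio.1 hy, hT l]), zero_mul]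
    exact contDiffAt_const.congr_of_eventuallyEq this
  · exact hq.contDiffAt (Ioi_mem_nhds (by linarith))

lemma sum_chi {x B : ℝ} (hB : 0 ≤ B) (h : ∀ i : ℕ, T i ≤ x → (i : ℝ) + 1 ≤ B) (n : ℕ) :
    ∑ i ∈ Finset.range n, smoothTransition (x - T i) ≤ B := by
  have h1 : ∀ i ∈ Finset.range n, smoothTransition (x - T i) ≤
      if i < ⌊B⌋₊ then (1:ℝ) else 0 := by
    intro i _
    split_ifs with hi
    · exact smoothTransition.le_one _
    · rcases le_or_gt (T i) x with hx | hx
      · exact absurd ((Nat.le_floor (by push_cast; exact h i hx) : i + 1 ≤ ⌊B⌋₊)) (by omega)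
      · rw [smoothTransition.zero_of_nonpos (by linarith)]
  refine (Finset.sum_le_sum h1).trans ?_
  rw [← Finset.sum_filter, Finset.sum_const, nsmul_eq_mul, mul_one]
  refine le_trans ?_ (Nat.floor_le hB)
  have : (Finset.range n).filter (fun i => i < ⌊B⌋₊) ⊆ Finset.range ⌊B⌋₊ := by
    intro i hi
    simp at hi ⊢
    exact hi.2
  have := Finset.card_le_card this
  rw [Finset.card_range] at this
  exact_mod_cast this

lemma q_bound {x B : ℝ} (hx : 0 < x) (hB : 0 ≤ B) (h : ∀ i : ℕ, T i ≤ x → (i : ℝ) + 1 ≤ B)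
    (hqs : ∀ (n : ℕ) (x : ℝ), |x| < n → q x = -∑ l ∈ Finset.range n,
        ee α (T l) x * sin (2 * φ l x)) : |q x| ≤ 8 * x ^ (α / 2 - 1) * B := by
  obtain ⟨n, hn⟩ := exists_nat_gt |x|
  rw [hqs n x hn, abs_neg]
  refine (Finset.abs_sum_le_sum_abs _ _).trans ?_
  refine le_trans (Finset.sum_le_sum (g := fun i => 8 * x ^ (α / 2 - 1) * smoothTransition (x - T i))
    fun i _ => ?_) ?_
  · rw [abs_mul]
    have h1 : 0 ≤ ee α (T i) x := by
      have := smoothTransition.nonneg (x - T i)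
      unfold ee
      positivity
    rw [abs_of_nonneg h1]
    refine (mul_le_of_le_one_right h1 (abs_sin_le_one _)).trans (le_of_eq ?_)
    unfold ee
    ring
  · rw [← Finset.mul_sum]
    have := sum_chi hB h n
    gcongr

end
end StarkAux

/-- Let `h : (0,∞) → (0,∞)` tend to `∞` at `∞`, let `(θ_j) ⊂ [0,π]` and let
`(E_j)` be a sequence of distinct reals. Then there is `q ∈ C^∞([0,∞))` with
`|q(x)| ≤ h(x)/(1 + x^{1-α/2})` for all `x > 0` such that for every `j` the perturbed Stark
eigen-equation `-u'' - x^α·u + q·u = E_j·u` has an `L²(ℝ⁺)` solution with boundary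
condition `u'(0)·cos θ_j = u(0)·sin θ_j`. -/
theorem stark_infinitely_many_eigenvalues
    (α : ℝ) (hα0 : 0 < α) (hα2 : α < 2)
    (h : ℝ → ℝ) (hpos : ∀ x : ℝ, 0 < x → 0 < h x)
    (htop : Filter.Tendsto h Filter.atTop Filter.atTop)
    (θ : ℕ → ℝ) (hθ : ∀ j, θ j ∈ Set.Icc 0 Real.pi)
    (E : ℕ → ℝ) (hE : Function.Injective E) :
    ∃ q : ℝ → ℝ, ContDiffOn ℝ (⊤ : ℕ∞) q (Set.Ici 0) ∧
      (∀ x : ℝ, 0 < x → |q x| ≤ h x / (1 + x ^ (1 - α / 2))) ∧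
      ∀ j : ℕ, ∃ u : ℝ → ℝ, ContDiffOn ℝ 2 u (Set.Ici 0) ∧
        (∀ x : ℝ, 0 < x →
          -(deriv (deriv u) x) - x ^ α * u x + q x * u x = E j * u x) ∧
        (∃ x ∈ Set.Ici (0 : ℝ), u x ≠ 0) ∧
        MeasureTheory.IntegrableOn (fun x => (u x) ^ 2) (Set.Ioi 0) ∧
        deriv u 0 * Real.cos (θ j) = u 0 * Real.sin (θ j) := by
  obtain ⟨δ, hδdef⟩ : ∃ δ : ℝ, δ = (1 - α / 2) / 2 := ⟨_, rfl⟩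
  have hδ : 0 < δ := by rw [hδdef]; linarith
  have hαδ : α / 2 = 1 - 2 * δ := by rw [hδdef]; ring
  have hαδ' : α / 2 - 1 = -(2 * δ) := by linarith
  choose k hk hk1 hk0 hke using fun i => StarkAux.exists_k α (E i) hα0
  have hkd : ∀ i, Differentiable ℝ (k i) := fun i => (hk i).differentiable (by simp)
  choose R X hp using fun i => StarkAux.phase_bound hα0 hδ hαδ (hkd i) (hk1 i) (hke i)
  have hR : ∀ i, 0 ≤ R i := fun i => (hp i).1
  choose K3 X3 h3 using fun i j => StarkAux.tame_osc hδ
    (show 0 ≤ 2 * (R i + R j) by linarith [hR i, hR j])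
    ((StarkAux.tame_g3 hα0 1 (hkd i) (hk1 i) (hke i) (hkd j) (hk1 j) (hke j)).congr_exp hαδ')
  choose K4 X4 h4 using fun i j => StarkAux.tame_osc hδ
    (show 0 ≤ 2 * (R i + R j) by linarith [hR i, hR j])
    ((StarkAux.tame_g4 hα0 (-(1 / (E i - E j)))
      (hkd i) (hk1 i) (hke i) (hkd j) (hk1 j) (hke j)).congr_exp hαδ')
  choose K2 X2 h2 using fun j => StarkAux.tame_osc hδ
    (show 0 ≤ 2 * R j by linarith [hR j])
    ((StarkAux.tame_g2 hα0 (-(α / 8)) (hkd j) (hk1 j) (hke j)).congr_exp hαδ')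
  have hTex : ∀ i : ℕ, ∃ T : ℝ, (i : ℝ) + 1 ≤ T ∧ (∀ x, T ≤ x → 16 * ((i : ℝ) + 1) ≤ h x) ∧
      (i : ℝ) + 1 ≤ T ^ δ ∧ X i ≤ T ∧ ∀ j ∈ Finset.range (i + 1), X j ≤ T ∧ X3 i j ≤ T ∧
        X4 i j ≤ T ∧ 3 * (K3 i j + K4 i j) * T ^ (-δ) ≤ (1 / 2) ^ i := by
    intro i
    refine Filter.Eventually.exists (f := atTop) ?_
    refine (eventually_ge_atTop _).and ((eventually_forall_ge_atTop.2
      (htop.eventually_ge_atTop _)).and (((tendsto_rpow_atTop hδ).eventually_ge_atTop _).and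
      ((eventually_ge_atTop _).and ?_)))
    rw [Finset.eventually_all]
    intro j _
    refine (eventually_ge_atTop _).and ((eventually_ge_atTop _).and ((eventually_ge_atTop _).and ?_))
    have := (tendsto_rpow_neg_atTop hδ).const_mul (3 * (K3 i j + K4 i j))
    rw [mul_zero] at this
    exact this.eventually_le_const (by positivity)
  choose T hTi hTh hTδ hTX0 hTX using hTex
  have hT1 : ∀ i, 1 ≤ T i := fun i => by
    have : (0:ℝ) ≤ i := Nat.cast_nonneg i
    linarith [hTi i]
  obtain ⟨φ, q, hφ0, hA, hqs⟩ := StarkAux.exists_sys (E := E) hα0 hk hk1 hTi (fun i => π / 2 - θ i)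
  have hqsm := StarkAux.q_smooth hk hk1 hA hT1 hqs
  have hq8 : ∀ x, 1 ≤ x → |q x| ≤ 8 * x ^ (-δ) := by
    intro x hx
    have hx0 : 0 < x := by linarith
    refine (StarkAux.q_bound hx0 (B := x ^ δ) (by positivity) (fun i hi => ?_) hqs).trans
      (le_of_eq ?_)
    · exact (hTδ i).trans (rpow_le_rpow (by linarith [hT1 i]) hi hδ.le)
    · rw [mul_assoc, ← rpow_add hx0]
      congr 2
      linarith
  refine ⟨q, hqsm.contDiffOn, ?_, fun j => ?_⟩
  · intro x hx
    have hh := hpos x hx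
    rcases lt_or_ge x 1 with hx1 | hx1
    · have := StarkAux.q_bound hx (B := 0) le_rfl (fun i hi => by linarith [hT1 i]) hqs
      rw [mul_zero] at this
      exact this.trans (by positivity)
    · have := StarkAux.q_bound hx (B := h x / 16) (by positivity)
        (fun i hi => by linarith [hTh i x hi]) hqs
      refine this.trans ?_
      have e1 : x ^ (α / 2 - 1) = (x ^ (1 - α / 2))⁻¹ := by rw [← rpow_neg hx.le]; congr 1; ring
      have e2 : 1 ≤ x ^ (1 - α / 2) := one_le_rpow hx1 (by linarith)
      rw [e1]
      have e3 : 8 * (x ^ (1 - α / 2))⁻¹ * (h x / 16) = h x / (2 * x ^ (1 - α / 2)) := by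
        field_simp; norm_num
      rw [e3]
      gcongr
      linarith
  · have hPc : Continuous (fun x : ℝ => |x| ^ α + E j) :=
      (continuous_abs.rpow_const (fun _ => Or.inr hα0.le)).add continuous_const
    obtain ⟨ℓ, u, hℓ, hu, hul, hode, hu0, hu0'⟩ := StarkAux.prufer (k j) (fun x => |x| ^ α + E j) q
      (φ j) ((hk j).of_le (by exact_mod_cast le_top)) (hk1 j) (hk0 j) hPc hqsm.continuous (hA j)
    obtain ⟨D, Y, hY, hD⟩ := StarkAux.decay hδ hE hk1 hp hq8 hA h3 h4 hT1
      (fun i j hij => by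
        obtain ⟨a1, a2, a3, _⟩ := hTX i j (Finset.mem_range.2 (by omega))
        exact ⟨hTX0 i, a1, a2, a3⟩)
      (fun i j hij => (hTX i j (Finset.mem_range.2 (by omega))).2.2.2) hqs j (h2 j) hℓ
    refine ⟨u, hu.contDiffOn, ?_, ?_, ?_, ?_⟩
    · intro x hx
      rw [hode x, abs_of_pos hx]
      ring
    · by_contra! hcon
      have hd : HasDerivAt u (deriv u 0) 0 :=
        (hu.differentiable (by norm_num)).differentiableAt.hasDerivAt
      have h1 : HasDerivWithinAt u 0 (Ici 0) 0 :=
        (hasDerivWithinAt_const (0:ℝ) (Ici 0) (0:ℝ)).congr (fun x hx => hcon x hx)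
          (hcon 0 self_mem_Ici)
      have h2 : deriv u 0 = 0 :=
        (uniqueDiffOn_Ici (0:ℝ) 0 self_mem_Ici).eq_deriv _ hd.hasDerivWithinAt h1
      have h3 := hcon 0 self_mem_Ici
      rw [hu0'] at h2
      rw [hu0] at h3
      have := sin_sq_add_cos_sq (φ j 0)
      rw [h2, h3] at this
      norm_num at this
    · have huc : Continuous (fun x => u x ^ 2) := hu.continuous.pow 2
      have hY0 : 0 < Y := by linarith
      rw [← Ioc_union_Ioi_eq_Ioi hY0.le]
      refine IntegrableOn.union (huc.integrableOn_Ioc) ?_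
      have hb : IntegrableOn (fun x : ℝ => exp (2 * D) * x ^ (-2 : ℝ)) (Ioi Y) :=
        (integrableOn_Ioi_rpow_of_lt (by norm_num) hY0).const_mul _
      refine Integrable.mono' hb huc.aestronglyMeasurable ?_
      filter_upwards [ae_restrict_mem measurableSet_Ioi] with x hx
      have hx0 : 0 < x := hY0.trans hx
      rw [norm_of_nonneg (by positivity)]
      refine (hul x).trans ?_
      rw [rpow_def_of_pos hx0, ← exp_add]
      refine exp_le_exp.2 ?_
      linarith [hD x (le_of_lt hx)]
    · rw [hu0, hu0', hφ0, sin_pi_div_two_sub, cos_pi_div_two_sub]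
      ring
end
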